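/- Assume that for every degree m ≤ n, every GC_m set possesses a maximal line (the GM conjecture up to degree n). Let X be a GC_n set with n ≥ 1, n ≠ 3, and let ℓ be an n-node line of X. Then: (i) |X_ℓ| = binomial(n,2) if and only if there exists a maximal line λ of X with λ ∩ ℓ ∩ X = ∅, and in this case X_ℓ = X \ (λ ∪ ℓ); (ii) |X_ℓ| = binomial(n−1,2) if and only if there exist two maximal lines λ', λ'' of X with λ' ∩ λ'' ∩ ℓ ∈ X, and in this case X_ℓ = X \ (λ' ∪ λ'' ∪ ℓ). -/

import Mathlib

open MvPolynomial

/-- Bivariate real polynomials. -/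
abbrev Poly2 : Type := MvPolynomial (Fin 2) ℝ

/-- Evaluation of a bivariate polynomial at a point of `ℝ²`. -/
noncomputable def evalPt (p : Poly2) (A : ℝ × ℝ) : ℝ :=
  MvPolynomial.eval (fun i => if i = 0 then A.1 else A.2) p

/-- `X` is an `n`-poised set: it has `(n+2 choose 2)` nodes and the only polynomial of
total degree at most `n` vanishing on all of `X` is the zero polynomial. -/
def IsPoised (n : ℕ) (X : Finset (ℝ × ℝ)) : Prop :=
  X.card = (n + 2).choose 2 ∧
    ∀ p : Poly2, p.totalDegree ≤ n → (∀ A ∈ X, evalPt p A = 0) → p = 0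

/-- `p` is an `n`-fundamental polynomial of the node `A` with respect to `X`. -/
def IsFund (n : ℕ) (X : Finset (ℝ × ℝ)) (A : ℝ × ℝ) (p : Poly2) : Prop :=
  p.totalDegree ≤ n ∧ evalPt p A = 1 ∧ ∀ B ∈ X, B ≠ A → evalPt p B = 0

/-- `X` is a `GC_n` set: `n`-poised and each node has a fundamental polynomial which is
a product of `n` polynomials of degree 1. -/
def IsGC (n : ℕ) (X : Finset (ℝ × ℝ)) : Prop :=
  IsPoised n X ∧
    ∀ A ∈ X, ∃ p : Poly2, IsFund n X A p ∧
      ∃ f : Fin n → Poly2, (∀ i, (f i).totalDegree = 1) ∧ p = ∏ i, f i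

/-- The nodes of `X` lying on the zero set of `ℓ`. -/
noncomputable def nodesOn (X : Finset (ℝ × ℝ)) (ℓ : Poly2) : Finset (ℝ × ℝ) :=
  @Finset.filter _ (fun A => evalPt ℓ A = 0) (Classical.decPred _) X

/-- `ℓ` is a `k`-node line of `X`: it has degree exactly 1 and passes through exactly
`k` nodes of `X`. -/
def IsKNodeLine (X : Finset (ℝ × ℝ)) (ℓ : Poly2) (k : ℕ) : Prop :=
  ℓ.totalDegree = 1 ∧ (nodesOn X ℓ).card = k

/-- A maximal line of an `n`-poised set: an `(n+1)`-node line. -/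
def IsMaximalLine (n : ℕ) (X : Finset (ℝ × ℝ)) (ℓ : Poly2) : Prop :=
  IsKNodeLine X ℓ (n + 1)

/-- The zero set of a polynomial, i.e. the line it determines when it has degree 1. -/
def zeroSet (ℓ : Poly2) : Set (ℝ × ℝ) := {A | evalPt ℓ A = 0}

/-- `μ(X)`: the number of maximal lines (as subsets of the plane) of `X`. -/
noncomputable def mu (n : ℕ) (X : Finset (ℝ × ℝ)) : ℕ :=
  {L : Set (ℝ × ℝ) | ∃ ℓ : Poly2, IsMaximalLine n X ℓ ∧ L = zeroSet ℓ}.ncard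

/-- The node `A` of `X` uses the line `ℓ`: `ℓ` divides a fundamental polynomial of `A`. -/
def Uses (n : ℕ) (X : Finset (ℝ × ℝ)) (ℓ : Poly2) (A : ℝ × ℝ) : Prop :=
  ∃ p : Poly2, IsFund n X A p ∧ ℓ ∣ p

/-- `X_ℓ`: the set of nodes of `X` using the line `ℓ`. -/
noncomputable def usesSet (n : ℕ) (X : Finset (ℝ × ℝ)) (ℓ : Poly2) : Finset (ℝ × ℝ) :=
  @Finset.filter _ (Uses n X ℓ) (Classical.decPred _) X

/-- The Gasca–Maeztu conjecture for degree `m`: every `GC_m` set has a maximal line. -/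
def GM (m : ℕ) : Prop :=
  ∀ Y : Finset (ℝ × ℝ), IsGC m Y → ∃ lam : Poly2, IsMaximalLine m Y lam

lemma evalPt_mul (p q : Poly2) (A : ℝ × ℝ) : evalPt (p * q) A = evalPt p A * evalPt q A := by
  simp [evalPt]

lemma evalPt_add (p q : Poly2) (A : ℝ × ℝ) : evalPt (p + q) A = evalPt p A + evalPt q A := by
  simp [evalPt]

lemma evalPt_sub (p q : Poly2) (A : ℝ × ℝ) : evalPt (p - q) A = evalPt p A - evalPt q A := by
  simp [evalPt]

lemma evalPt_C (c : ℝ) (A : ℝ × ℝ) : evalPt (C c) A = c := by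
  simp [evalPt]

lemma evalPt_zero (A : ℝ × ℝ) : evalPt 0 A = 0 := by
  simp [evalPt]

lemma evalPt_one (A : ℝ × ℝ) : evalPt 1 A = 1 := by
  simp [evalPt]

lemma evalPt_prod {ι : Type*} (s : Finset ι) (f : ι → Poly2) (A : ℝ × ℝ) :
    evalPt (∏ i ∈ s, f i) A = ∏ i ∈ s, evalPt (f i) A := by
  simp [evalPt, map_prod]

lemma evalPt_sum {ι : Type*} (s : Finset ι) (f : ι → Poly2) (A : ℝ × ℝ) :
    evalPt (∑ i ∈ s, f i) A = ∑ i ∈ s, evalPt (f i) A := by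
  simp [evalPt, map_sum]

lemma evalPt_lin (a b c : ℝ) (A : ℝ × ℝ) :
    evalPt (C a * X 0 + C b * X 1 + C c) A = a * A.1 + b * A.2 + c := by
  simp [evalPt]

lemma line_form {f : Poly2} (h : f.totalDegree = 1) :
    ∃ a b c : ℝ, (a ≠ 0 ∨ b ≠ 0) ∧ f = C a * X 0 + C b * X 1 + C c := by
  have key : f = C (f.coeff (Finsupp.single 0 1)) * X 0 + C (f.coeff (Finsupp.single 1 1)) * X 1
      + C (f.coeff 0) := by
    ext m
    simp only [coeff_add, coeff_C_mul, coeff_X, coeff_C]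
    by_cases h0 : m = 0
    · subst h0
      simp
    by_cases h1 : m = Finsupp.single 0 1
    · subst h1
      simp [Finsupp.single_left_inj, Ne.symm h0]
    by_cases h2 : m = Finsupp.single 1 1
    · subst h2
      simp [Finsupp.single_left_inj, Ne.symm h0]
    rw [if_neg (fun h => h1 h.symm), if_neg (fun h => h2 h.symm), if_neg (fun h => h0 h.symm)]
    simp only [mul_zero, add_zero]
    apply coeff_eq_zero_of_totalDegree_lt
    rw [h]
    have e : ∑ i ∈ m.support, m i = m 0 + m 1 := by
      rw [Finset.sum_subset (Finset.subset_univ _), Fin.sum_univ_two]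
      intro x _ hx
      simpa using hx
    rw [e]
    by_contra hlt
    have : (m 0 = 0 ∧ m 1 = 0) ∨ (m 0 = 1 ∧ m 1 = 0) ∨ (m 0 = 0 ∧ m 1 = 1) := by omega
    rcases this with ⟨ha, hb⟩ | ⟨ha, hb⟩ | ⟨ha, hb⟩
    · apply h0; ext i; fin_cases i <;> simp [ha, hb]
    · apply h1; ext i; fin_cases i <;> simp [ha, hb]
    · apply h2; ext i; fin_cases i <;> simp [ha, hb]
  refine ⟨_, _, _, ?_, key⟩
  by_contra hc
  push Not at hc
  rw [hc.1, hc.2] at key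
  rw [key] at h
  simp at h

lemma totalDegree_lin {a b : ℝ} (c : ℝ) (h : a ≠ 0 ∨ b ≠ 0) :
    (C a * X 0 + C b * X 1 + C c : Poly2).totalDegree = 1 := by
  apply le_antisymm
  · refine (totalDegree_add _ _).trans (max_le ((totalDegree_add _ _).trans (max_le ?_ ?_)) ?_)
    · refine (totalDegree_mul _ _).trans ?_
      simp
    · refine (totalDegree_mul _ _).trans ?_
      simp
    · simp
  · by_contra hlt
    have h0 : (C a * X 0 + C b * X 1 + C c : Poly2).totalDegree = 0 := by omega
    rw [totalDegree_eq_zero_iff_eq_C] at h0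
    have e : ∀ A : ℝ × ℝ, a * A.1 + b * A.2 + c =
        coeff 0 (C a * X 0 + C b * X 1 + C c : Poly2) := by
      intro A
      rw [← evalPt_lin, h0, evalPt_C]
      simp
    have e0 := e (0, 0)
    have e1 := e (1, 0)
    have e2 := e (0, 1)
    simp only at e0 e1 e2
    rcases h with h | h
    · apply h; linarith
    · apply h; linarith

/-- Two substitutions that agree modulo `f` give the same result modulo `f`. -/
lemma dvd_sub_aeval (f p : Poly2) (φ : Fin 2 → Poly2) (h : ∀ i, f ∣ X i - φ i) :
    f ∣ p - aeval φ p := by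
  induction p using MvPolynomial.induction_on with
  | C a => simp
  | add p q hp hq =>
    have : p + q - aeval φ (p + q) = (p - aeval φ p) + (q - aeval φ q) := by
      simp only [map_add]; ring
    rw [this]
    exact dvd_add hp hq
  | mul_X p i hp =>
    have : p * X i - aeval φ (p * X i) = (p - aeval φ p) * X i + aeval φ p * (X i - φ i) := by
      simp only [map_mul, aeval_X]; ring
    rw [this]
    exact dvd_add (Dvd.dvd.mul_right hp _) (Dvd.dvd.mul_left (h i) _)

lemma eval_aeval_uni (ψ : Fin 2 → Polynomial ℝ) (p : Poly2) (t : ℝ) :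
    (aeval ψ p).eval t = MvPolynomial.eval (fun i => (ψ i).eval t) p := by
  induction p using MvPolynomial.induction_on with
  | C a => simp
  | add p q hp hq => simp [hp, hq]
  | mul_X p i hp => simp [hp]

lemma aeval_aeval_uni (ψ : Fin 2 → Polynomial ℝ) (p τ : Poly2) :
    Polynomial.aeval τ (aeval ψ p) = aeval (fun i => Polynomial.aeval τ (ψ i)) p := by
  induction p using MvPolynomial.induction_on with
  | C a => simp
  | add p q hp hq => simp [hp, hq]
  | mul_X p i hp => simp [hp]

/-- A polynomial with more zeros on a line than its degree is divisible by the line. -/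
lemma line_dvd {f p : Poly2} (hf : f.totalDegree = 1) (T : Finset (ℝ × ℝ))
    (hT : ∀ A ∈ T, evalPt f A = 0) (hp : ∀ A ∈ T, evalPt p A = 0)
    (hd : p.totalDegree < T.card) :
    ∃ r, p = f * r ∧ (r = 0 ∨ r.totalDegree + 1 ≤ p.totalDegree) := by
  obtain ⟨a, b, c, hab, rfl⟩ := line_form hf
  have hN : a ^ 2 + b ^ 2 ≠ 0 := by
    rcases hab with h | h
    · have := sq_nonneg b; have := pow_pos (abs_pos.mpr h) 2; rw [sq_abs] at this; linarith
    · have := sq_nonneg a; have := pow_pos (abs_pos.mpr h) 2; rw [sq_abs] at this; linarith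
  set N := a ^ 2 + b ^ 2 with hNdef
  -- parametrisation of the line
  let ψ : Fin 2 → Polynomial ℝ := fun i =>
    if i = 0 then Polynomial.C (-(c * a / N)) + Polynomial.C (-b) * Polynomial.X
    else Polynomial.C (-(c * b / N)) + Polynomial.C a * Polynomial.X
  let r : Polynomial ℝ := aeval ψ p
  have hrdeg : r.natDegree ≤ p.totalDegree := by
    have := MvPolynomial.aeval_natDegree_le (m := p.totalDegree) (n := 1) p le_rfl ψ (by
      intro i
      fin_cases i
      · simp only [ψ]; simp only [Fin.zero_eta, Fin.isValue, if_true]; compute_degree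
      · simp only [ψ]; simp only [Fin.mk_one, Fin.isValue, one_ne_zero, if_false]; compute_degree)
    simpa using this
  have hreval : ∀ t : ℝ, r.eval t = evalPt p (-(c * a / N) - b * t, -(c * b / N) + a * t) := by
    intro t
    rw [evalPt]
    simp only [r, eval_aeval_uni]
    congr 2
    ext i
    fin_cases i
    · simp [ψ]; ring
    · simp [ψ]
  have hr0 : r = 0 := by
    by_contra hr
    let g : ℝ × ℝ → ℝ := fun A => (-b * A.1 + a * A.2) / N
    have hpar : ∀ A ∈ T, A = (-(c * a / N) - b * g A, -(c * b / N) + a * g A) := by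
      intro A hA
      have h := hT A hA
      rw [evalPt_lin] at h
      have hc : c = -(a * A.1 + b * A.2) := by linarith
      ext
      · simp only [g]; field_simp; rw [hc, hNdef]; ring
      · simp only [g]; field_simp; rw [hc, hNdef]; ring
    have hinj : Set.InjOn g T := by
      intro A hA B hB hAB
      rw [hpar A hA, hpar B hB, hAB]
    have hsub : T.image g ⊆ r.roots.toFinset := by
      intro t ht
      obtain ⟨A, hA, rfl⟩ := Finset.mem_image.mp ht
      rw [Multiset.mem_toFinset, Polynomial.mem_roots hr, Polynomial.IsRoot, hreval, ← hpar A hA]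
      exact hp A hA
    have h1 := Finset.card_le_card hsub
    rw [Finset.card_image_of_injOn hinj] at h1
    have h2 := Multiset.toFinset_card_le r.roots
    have h3 := Polynomial.card_roots' r
    omega
  have hdvd : (C a * X 0 + C b * X 1 + C c : Poly2) ∣ p := by
    let τ : Poly2 := C (-b * N⁻¹) * X 0 + C (a * N⁻¹) * X 1
    have h := dvd_sub_aeval (C a * X 0 + C b * X 1 + C c) p
      (fun i => Polynomial.aeval τ (ψ i)) (by
        have rel : (C a * C a + C b * C b) * C N⁻¹ = (1 : Poly2) := by
          rw [← C_mul, ← C_mul, ← C_add, ← C_mul, ← C_1]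
          congr 1
          field_simp
          rw [hNdef]
        intro i
        fin_cases i
        · refine ⟨C a * C N⁻¹, ?_⟩
          simp only [ψ, τ, div_eq_mul_inv]
          simp [Polynomial.aeval_C, algebraMap_eq]
          linear_combination (-(X 0 : Poly2)) * rel
        · refine ⟨C b * C N⁻¹, ?_⟩
          simp only [ψ, τ, div_eq_mul_inv]
          simp [Polynomial.aeval_C, algebraMap_eq]
          linear_combination (-(X 1 : Poly2)) * rel)
    rw [← aeval_aeval_uni, show aeval ψ p = 0 from hr0] at h
    simpa using h
  obtain ⟨q, hq⟩ := hdvd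
  refine ⟨q, hq, ?_⟩
  by_cases hq0 : q = 0
  · exact Or.inl hq0
  · right
    have hne : (C a * X 0 + C b * X 1 + C c : Poly2) ≠ 0 := by
      intro h; rw [h] at hf; simp at hf
    rw [hq, totalDegree_mul_of_isDomain hne hq0, hf]
    omega

lemma totalDegree_mul_line {f q : Poly2} (hf : f.totalDegree = 1) (hq : q ≠ 0) :
    (f * q).totalDegree = q.totalDegree + 1 := by
  have hne : f ≠ 0 := by
    intro h; rw [h] at hf; simp at hf
  rw [totalDegree_mul_of_isDomain hne hq, hf]
  omega

/-- Lines with two common points are proportional. -/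
lemma line_eq {f g : Poly2} (hf : f.totalDegree = 1) (hg : g.totalDegree = 1) {P Q : ℝ × ℝ}
    (hPQ : P ≠ Q) (h1 : evalPt f P = 0) (h2 : evalPt f Q = 0) (h3 : evalPt g P = 0)
    (h4 : evalPt g Q = 0) : ∃ c : ℝ, c ≠ 0 ∧ g = f * C c := by
  obtain ⟨r, hr, hd⟩ := line_dvd (p := g) hf {P, Q} (by simp [h1, h2]) (by simp [h3, h4])
    (by rw [Finset.card_pair hPQ, hg]; norm_num)
  have hr0 : r ≠ 0 := by
    rintro rfl
    rw [hr] at hg; simp at hg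
  rcases hd with hd | hd
  · exact absurd hd hr0
  · have : r.totalDegree = 0 := by omega
    rw [totalDegree_eq_zero_iff_eq_C] at this
    refine ⟨coeff 0 r, ?_, by rw [← this]; exact hr⟩
    intro h
    apply hr0
    rw [this, h, C_0]

lemma line_zero {f g : Poly2} (hf : f.totalDegree = 1) (hg : g.totalDegree = 1) {P Q : ℝ × ℝ}
    (hPQ : P ≠ Q) (h1 : evalPt f P = 0) (h2 : evalPt f Q = 0) (h3 : evalPt g P = 0)
    (h4 : evalPt g Q = 0) {A : ℝ × ℝ} (hA : evalPt f A = 0) : evalPt g A = 0 := by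
  obtain ⟨c, -, rfl⟩ := line_eq hf hg hPQ h1 h2 h3 h4
  rw [evalPt_mul, hA, zero_mul]

/-- The line through two points. -/
lemma exists_line {P Q : ℝ × ℝ} (h : P ≠ Q) :
    ∃ f : Poly2, f.totalDegree = 1 ∧ evalPt f P = 0 ∧ evalPt f Q = 0 := by
  refine ⟨C (Q.2 - P.2) * X 0 + C (P.1 - Q.1) * X 1 + C (P.2 * Q.1 - P.1 * Q.2),
    totalDegree_lin _ ?_, ?_, ?_⟩
  · by_contra hc
    push Not at hc
    apply h
    ext <;> linarith [hc.1, hc.2]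
  · rw [evalPt_lin]; ring
  · rw [evalPt_lin]; ring

/-- A line through `P` avoiding `Q`. -/
lemma exists_line_avoid {P Q : ℝ × ℝ} (h : P ≠ Q) :
    ∃ f : Poly2, f.totalDegree = 1 ∧ evalPt f P = 0 ∧ evalPt f Q ≠ 0 := by
  have hor : P.1 - Q.1 ≠ 0 ∨ P.2 - Q.2 ≠ 0 := by
    by_contra hc
    push Not at hc
    apply h
    ext <;> linarith [hc.1, hc.2]
  refine ⟨C (P.1 - Q.1) * X 0 + C (P.2 - Q.2) * X 1
      + C (-((P.1 - Q.1) * P.1 + (P.2 - Q.2) * P.2)), totalDegree_lin _ hor, ?_, ?_⟩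
  · rw [evalPt_lin]; ring
  · rw [evalPt_lin]
    intro h0
    have : (P.1 - Q.1) ^ 2 + (P.2 - Q.2) ^ 2 = 0 := by linarith
    rcases hor with h1 | h1
    · exact h1 (by nlinarith [sq_nonneg (P.1 - Q.1), sq_nonneg (P.2 - Q.2)])
    · exact h1 (by nlinarith [sq_nonneg (P.1 - Q.1), sq_nonneg (P.2 - Q.2)])

lemma zeroSet_infinite {f : Poly2} (hf : f.totalDegree = 1) : (zeroSet f).Infinite := by
  obtain ⟨a, b, c, hab, rfl⟩ := line_form hf
  have hN : a ^ 2 + b ^ 2 ≠ 0 := by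
    intro h
    rcases hab with h1 | h1
    · exact h1 (by nlinarith [sq_nonneg a, sq_nonneg b])
    · exact h1 (by nlinarith [sq_nonneg a, sq_nonneg b])
  refine Set.infinite_of_injective_forall_mem
    (f := fun t : ℝ => ((-(c * a / (a ^ 2 + b ^ 2)) - b * t,
      -(c * b / (a ^ 2 + b ^ 2)) + a * t) : ℝ × ℝ)) ?_ ?_
  · intro s t hst
    simp only [Prod.mk.injEq] at hst
    rcases hab with h1 | h1
    · exact mul_left_cancel₀ h1 (by linarith [hst.2])
    · exact mul_left_cancel₀ h1 (by linarith [hst.1])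
  · intro t
    simp only [zeroSet, Set.mem_ofPred_eq, evalPt_lin]
    field_simp
    ring

/-- Any number of points of a line outside of a finite set. -/
lemma exists_points {f : Poly2} (hf : f.totalDegree = 1) (F : Finset (ℝ × ℝ)) (k : ℕ) :
    ∃ T : Finset (ℝ × ℝ), T.card = k ∧ ∀ A ∈ T, evalPt f A = 0 ∧ A ∉ F := by
  have hinf : (zeroSet f \ (F : Set (ℝ × ℝ))).Infinite :=
    (zeroSet_infinite hf).sdiff F.finite_toSet
  obtain ⟨T, hT, hc⟩ := hinf.exists_subset_card_eq k
  refine ⟨T, hc, fun A hA => ?_⟩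
  have := hT hA
  exact ⟨this.1, fun h => this.2 h⟩

lemma mem_nodesOn {X : Finset (ℝ × ℝ)} {ℓ : Poly2} {A : ℝ × ℝ} :
    A ∈ nodesOn X ℓ ↔ A ∈ X ∧ evalPt ℓ A = 0 := by
  simp [nodesOn]

lemma mem_offLine {X : Finset (ℝ × ℝ)} {ℓ : Poly2} {A : ℝ × ℝ} :
    A ∈ X \ nodesOn X ℓ ↔ A ∈ X ∧ evalPt ℓ A ≠ 0 := by
  simp only [Finset.mem_sdiff, mem_nodesOn]
  tauto

lemma card_offLine (X : Finset (ℝ × ℝ)) (ℓ : Poly2) :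
    (X \ nodesOn X ℓ).card + (nodesOn X ℓ).card = X.card :=
  Finset.card_sdiff_add_card_eq_card (fun _ hA => (mem_nodesOn.mp hA).1)

/-- A convenient reformulation of `IsGC`. -/
structure GCs (n : ℕ) (X : Finset (ℝ × ℝ)) : Prop where
  card : X.card = (n + 2).choose 2
  poised : ∀ p : Poly2, p.totalDegree ≤ n → (∀ A ∈ X, evalPt p A = 0) → p = 0
  lines : ∀ A ∈ X, ∃ f : Fin n → Poly2, (∀ i, (f i).totalDegree = 1) ∧
    (∀ i, evalPt (f i) A ≠ 0) ∧ ∀ B ∈ X, B ≠ A → ∃ i, evalPt (f i) B = 0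

lemma totalDegree_prod_lines {ι : Type*} (s : Finset ι) (f : ι → Poly2)
    (h : ∀ i ∈ s, (f i).totalDegree = 1) : (∏ i ∈ s, f i).totalDegree ≤ s.card := by
  refine (totalDegree_finsetProd s f).trans ?_
  rw [Finset.sum_congr rfl h]
  simp

lemma GCs.of_isGC {n : ℕ} {X : Finset (ℝ × ℝ)} (h : IsGC n X) : GCs n X := by
  refine ⟨h.1.1, h.1.2, fun A hA => ?_⟩
  obtain ⟨p, hp, f, hf, rfl⟩ := h.2 A hA
  refine ⟨f, hf, fun i hi => ?_, fun B hB hBA => ?_⟩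
  · have := hp.2.1
    rw [evalPt_prod, Finset.prod_eq_zero (Finset.mem_univ i) hi] at this
    exact zero_ne_one this
  · have := hp.2.2 B hB hBA
    rw [evalPt_prod, Finset.prod_eq_zero_iff] at this
    obtain ⟨i, -, hi⟩ := this
    exact ⟨i, hi⟩

lemma totalDegree_C_mul {c : ℝ} (hc : c ≠ 0) (p : Poly2) :
    (C c * p).totalDegree = p.totalDegree := by
  by_cases hp : p = 0
  · simp [hp]
  rw [totalDegree_mul_of_isDomain (by simpa using hc) hp]
  simp

lemma GCs.isGC {n : ℕ} {X : Finset (ℝ × ℝ)} (h : GCs n X) : IsGC n X := by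
  refine ⟨⟨h.card, h.poised⟩, fun A hA => ?_⟩
  obtain ⟨f, hf, hfA, hfB⟩ := h.lines A hA
  have hd : ∀ i, (C (evalPt (f i) A)⁻¹ * f i).totalDegree = 1 := fun i => by
    rw [totalDegree_C_mul (inv_ne_zero (hfA i)), hf i]
  refine ⟨∏ i, (C (evalPt (f i) A)⁻¹ * f i), ⟨?_, ?_, ?_⟩, _, hd, rfl⟩
  · simpa using totalDegree_prod_lines Finset.univ _ (fun i _ => hd i)
  · rw [evalPt_prod]
    apply Finset.prod_eq_one
    intro i _
    rw [evalPt_mul, evalPt_C, inv_mul_cancel₀ (hfA i)]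
  · intro B hB hBA
    obtain ⟨i, hi⟩ := hfB B hB hBA
    rw [evalPt_prod]
    apply Finset.prod_eq_zero (Finset.mem_univ i)
    rw [evalPt_mul, hi, mul_zero]

/-- If more than `n` points of a line are covered by `n` lines, the line is one of them. -/
lemma line_mem {n : ℕ} {f : Fin n → Poly2} (hf : ∀ i, (f i).totalDegree = 1) {τ : Poly2}
    (hτ : τ.totalDegree = 1) {T : Finset (ℝ × ℝ)} (hT : ∀ t ∈ T, evalPt τ t = 0)
    (hcov : ∀ t ∈ T, ∃ i, evalPt (f i) t = 0) (hc : n < T.card) :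
    ∃ i, ∃ c : ℝ, c ≠ 0 ∧ f i = τ * C c := by
  obtain ⟨t0, ht0⟩ : T.Nonempty := Finset.card_pos.mp (by omega)
  have : Nonempty (Fin n) := ⟨(hcov t0 ht0).choose⟩
  choose! φ hφ using hcov
  obtain ⟨P, hP, Q, hQ, hne, heq⟩ := Finset.exists_ne_map_eq_of_card_lt_of_maps_to
    (s := T) (t := (Finset.univ : Finset (Fin n))) (by simpa using hc) (f := φ)
    (fun _ _ => Finset.mem_coe.mpr (Finset.mem_univ _))
  refine ⟨φ P, line_eq hτ (hf _) hne (hT P hP) (hT Q hQ) (hφ P hP) ?_⟩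
  rw [heq]
  exact hφ Q hQ

/-- `n` points of a line covered by `n` other lines: each of the lines contains exactly one. -/
lemma line_match {n : ℕ} {f : Fin n → Poly2} (hf : ∀ i, (f i).totalDegree = 1) {τ : Poly2}
    (hτ : τ.totalDegree = 1) {T : Finset (ℝ × ℝ)} (hT : ∀ t ∈ T, evalPt τ t = 0)
    (hcov : ∀ t ∈ T, ∃ i, evalPt (f i) t = 0) (hc : T.card = n)
    (hne : ∀ i, ∃ Q, evalPt τ Q = 0 ∧ evalPt (f i) Q ≠ 0) :
    (∀ i, ∃ t ∈ T, evalPt (f i) t = 0) ∧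
      ∀ t ∈ T, ∀ i j, evalPt (f i) t = 0 → evalPt (f j) t = 0 → i = j := by
  have huniq : ∀ i, ∀ s ∈ T, ∀ t ∈ T, evalPt (f i) s = 0 → evalPt (f i) t = 0 → s = t := by
    intro i s hs t ht h1 h2
    by_contra hst
    obtain ⟨Q, hQ1, hQ2⟩ := hne i
    exact hQ2 (line_zero hτ (hf i) hst (hT s hs) (hT t ht) h1 h2 hQ1)
  rcases Nat.eq_zero_or_pos n with hn | hn
  · subst hn
    rw [Finset.card_eq_zero] at hc
    subst hc
    exact ⟨fun i => i.elim0, fun t ht => absurd ht (Finset.notMem_empty t)⟩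
  have : Nonempty (Fin n) := ⟨⟨0, hn⟩⟩
  choose! φ hφ using hcov
  have hinj : Set.InjOn φ T := by
    intro s hs t ht hst
    exact huniq (φ s) s hs t ht (hφ s hs) (by rw [hst]; exact hφ t ht)
  have himg : T.image φ = Finset.univ := by
    apply Finset.eq_univ_of_card
    rw [Finset.card_image_of_injOn hinj, hc, Fintype.card_fin]
  have hsurj : ∀ i, ∃ t ∈ T, φ t = i := by
    intro i
    have : i ∈ T.image φ := by rw [himg]; exact Finset.mem_univ i
    simpa using this
  refine ⟨fun i => ?_, fun t ht => ?_⟩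
  · obtain ⟨t, ht, rfl⟩ := hsurj i
    exact ⟨t, ht, hφ t ht⟩
  · have key : ∀ i, evalPt (f i) t = 0 → i = φ t := by
      intro i hi
      obtain ⟨s, hs, rfl⟩ := hsurj i
      rw [huniq _ s hs t ht (hφ s hs) hi]
    intro i j hi hj
    rw [key i hi, key j hj]

lemma GCs.card_line_le {n : ℕ} {X : Finset (ℝ × ℝ)} (h : GCs n X) {τ : Poly2}
    (hτ : τ.totalDegree = 1) : (nodesOn X τ).card ≤ n + 1 := by
  by_contra hlt
  obtain ⟨A, hA⟩ : (nodesOn X τ).Nonempty := Finset.card_pos.mp (by omega)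
  obtain ⟨hAX, hAτ⟩ := mem_nodesOn.mp hA
  obtain ⟨f, hf, hfA, hfB⟩ := h.lines A hAX
  obtain ⟨i, c, -, hi⟩ := line_mem hf hτ (T := (nodesOn X τ).erase A)
    (fun t ht => (mem_nodesOn.mp (Finset.mem_of_mem_erase ht)).2)
    (fun t ht => hfB t (mem_nodesOn.mp (Finset.mem_of_mem_erase ht)).1 (Finset.ne_of_mem_erase ht))
    (by rw [Finset.card_erase_of_mem hA]; omega)
  apply hfA i
  rw [hi, evalPt_mul, hAτ, zero_mul]

lemma choose_step (n : ℕ) : (n + 1 + 1).choose 2 = (n + 1).choose 2 + (n + 1) := by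
  have h := Nat.choose_succ_succ' (n + 1) 1
  rw [Nat.choose_one_right] at h
  norm_num at h ⊢
  omega

/-- Removing a maximal line. -/
lemma GCs.remove {n : ℕ} {X : Finset (ℝ × ℝ)} (h : GCs (n + 1) X) {τ : Poly2}
    (hτ : IsMaximalLine (n + 1) X τ) : GCs n (X \ nodesOn X τ) := by
  refine ⟨?_, ?_, ?_⟩
  · have h1 := card_offLine X τ
    rw [hτ.2, h.card] at h1
    have h2 := choose_step (n + 1)
    simp only [Nat.add_assoc] at h1 h2 ⊢
    norm_num at h1 h2 ⊢
    omega
  · intro p hp hz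
    have hne : τ ≠ 0 := by
      intro h0
      have := hτ.1
      rw [h0] at this; simp at this
    have : τ * p = 0 := by
      apply h.poised
      · refine (totalDegree_mul _ _).trans ?_
        rw [hτ.1]; omega
      · intro A hA
        rw [evalPt_mul]
        by_cases hA' : evalPt τ A = 0
        · rw [hA', zero_mul]
        · rw [hz A (mem_offLine.mpr ⟨hA, hA'⟩), mul_zero]
    exact (mul_eq_zero.mp this).resolve_left hne
  · intro A hA
    obtain ⟨hAX, hAτ⟩ := mem_offLine.mp hA
    obtain ⟨f, hf, hfA, hfB⟩ := h.lines A hAX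
    obtain ⟨i, c, hc, hi⟩ := line_mem hf hτ.1 (T := nodesOn X τ)
      (fun t ht => (mem_nodesOn.mp ht).2)
      (fun t ht => hfB t (mem_nodesOn.mp ht).1 (by
        rintro rfl
        exact hAτ (mem_nodesOn.mp ht).2))
      (by rw [hτ.2]; omega)
    refine ⟨fun j => f (i.succAbove j), fun j => hf _, fun j => hfA _, fun B hB hBA => ?_⟩
    obtain ⟨hBX, hBτ⟩ := mem_offLine.mp hB
    obtain ⟨j, hj⟩ := hfB B hBX hBA
    have hji : j ≠ i := by
      rintro rfl
      rw [hi, evalPt_mul, evalPt_C] at hj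
      exact (mul_ne_zero hBτ hc) hj
    obtain ⟨k, rfl⟩ := Fin.exists_succAbove_eq hji
    exact ⟨k, hj⟩

/-- Two different maximal lines meet at a node. -/
lemma GCs.maximal_meet {n : ℕ} {X : Finset (ℝ × ℝ)} (h : GCs (n + 1) X) {σ τ : Poly2}
    (hσ : IsMaximalLine (n + 1) X σ) (hτ : IsMaximalLine (n + 1) X τ) :
    ∃ A ∈ X, evalPt σ A = 0 ∧ evalPt τ A = 0 := by
  by_contra hc
  push Not at hc
  have h1 := (h.remove hσ).card_line_le hτ.1
  have h2 : nodesOn (X \ nodesOn X σ) τ = nodesOn X τ := by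
    ext A
    simp only [mem_nodesOn, mem_offLine]
    constructor
    · rintro ⟨⟨a, b⟩, c⟩
      exact ⟨a, c⟩
    · rintro ⟨a, c⟩
      exact ⟨⟨a, fun b => hc A a b c⟩, c⟩
  rw [h2, hτ.2] at h1
  omega

/-- Two lines which are different have at most one common node. -/
lemma card_inter_le_one {σ τ : Poly2} (hσ : σ.totalDegree = 1) (hτ : τ.totalDegree = 1)
    {Q : ℝ × ℝ} (h1 : evalPt σ Q = 0) (h2 : evalPt τ Q ≠ 0) (S : Finset (ℝ × ℝ))
    (hS : ∀ A ∈ S, evalPt σ A = 0 ∧ evalPt τ A = 0) : S.card ≤ 1 := by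
  rw [Finset.card_le_one]
  intro A hA B hB
  by_contra hne
  exact h2 (line_zero hσ hτ hne (hS A hA).1 (hS B hB).1 (hS A hA).2 (hS B hB).2 h1)

/-- Injectivity: a line through the common node of two maximal lines `α`, `β` of `X \ λ`
which miss the nodes of `λ` cannot divide the fundamental polynomials of two nodes of `λ`. -/
lemma factor_inj {n : ℕ} {X : Finset (ℝ × ℝ)} {lam α β m p p' : Poly2}
    (hlam : IsMaximalLine (n + 1) X lam)
    (hα : IsMaximalLine n (X \ nodesOn X lam) α) (hβ : IsMaximalLine n (X \ nodesOn X lam) β)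
    (hαS : ∀ B ∈ X, evalPt lam B = 0 → evalPt α B ≠ 0)
    (hβS : ∀ B ∈ X, evalPt lam B = 0 → evalPt β B ≠ 0)
    {P Q D c c' : ℝ × ℝ} (hPα : evalPt α P = 0)
    (hQα : evalPt α Q = 0) (hQβ : evalPt β Q ≠ 0) (hPβ : evalPt β P = 0)
    (hm : m.totalDegree = 1) (hmP : evalPt m P = 0) (hmD : evalPt m D = 0) (hDX : D ∈ X)
    (hDlam : evalPt lam D = 0) (hc : c ∈ nodesOn X lam) (hc' : c' ∈ nodesOn X lam) (hcc : c ≠ c')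
    (hp : p.totalDegree ≤ n + 1) (hp' : p'.totalDegree ≤ n + 1)
    (hpc : evalPt p c ≠ 0) (hpc' : evalPt p' c' ≠ 0)
    (hpz : ∀ B ∈ X, B ≠ c → evalPt p B = 0) (hpz' : ∀ B ∈ X, B ≠ c' → evalPt p' B = 0)
    (hmp : m ∣ p) (hmp' : m ∣ p') : False := by
  obtain ⟨A, hA, hAz⟩ := exists_points hα.1 X 1
  obtain ⟨a, rfl⟩ := Finset.card_eq_one.mp hA
  obtain ⟨haα, haX⟩ := hAz a (Finset.mem_singleton_self a)
  obtain ⟨x, y, hxy, hxa⟩ : ∃ x y : ℝ, (x ≠ 0 ∨ y ≠ 0) ∧ x * evalPt p a + y * evalPt p' a = 0 := by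
    by_cases h0 : evalPt p a = 0
    · exact ⟨1, 0, Or.inl one_ne_zero, by simp [h0]⟩
    · exact ⟨-evalPt p' a, evalPt p a, Or.inr h0, by ring⟩
  set g : Poly2 := C x * p + C y * p' with hg
  have hge : ∀ B, evalPt g B = x * evalPt p B + y * evalPt p' B := by
    intro B
    simp only [hg, evalPt_add, evalPt_mul, evalPt_C]
  have hgd : g.totalDegree ≤ n + 1 := by
    refine (totalDegree_add _ _).trans (max_le ?_ ?_)
    · refine (totalDegree_mul _ _).trans ?_
      simpa using hp
    · refine (totalDegree_mul _ _).trans ?_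
      simpa using hp'
  have hgz : ∀ B ∈ X, B ≠ c → B ≠ c' → evalPt g B = 0 := by
    intro B hB h1 h2
    rw [hge, hpz B hB h1, hpz' B hB h2]; ring
  obtain ⟨hcX, hclam⟩ := mem_nodesOn.mp hc
  obtain ⟨hcX', hclam'⟩ := mem_nodesOn.mp hc'
  suffices hlz : ∀ E, evalPt lam E = 0 → evalPt g E = 0 by
    have h1 := hlz c hclam
    have h2 := hlz c' hclam'
    rw [hge, hpz' c hcX hcc, mul_zero, add_zero] at h1
    rw [hge, hpz c' hcX' hcc.symm, mul_zero, zero_add] at h2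
    rcases hxy with hx | hy
    · exact mul_ne_zero hx hpc h1
    · exact mul_ne_zero hy hpc' h2
  obtain ⟨h, hgh, hhd⟩ := line_dvd (p := g) hα.1 (insert a (nodesOn (X \ nodesOn X lam) α))
    (by
      intro B hB
      rcases Finset.mem_insert.mp hB with rfl | hB
      · exact haα
      · exact (mem_nodesOn.mp hB).2)
    (by
      intro B hB
      rcases Finset.mem_insert.mp hB with rfl | hB
      · rw [hge, hxa]
      · obtain ⟨h1, h2⟩ := mem_offLine.mp (mem_nodesOn.mp hB).1
        exact hgz B h1 (fun e => h2 (e ▸ hclam)) (fun e => h2 (e ▸ hclam')))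
    (by
      rw [Finset.card_insert_of_notMem, hα.2]
      · omega
      · intro hmem
        exact haX (mem_offLine.mp (mem_nodesOn.mp hmem).1).1)
  have hhn : h.totalDegree ≤ n := by
    rcases hhd with rfl | hhd
    · simp
    · omega
  have hzero : ∀ B, evalPt g B = 0 → evalPt α B ≠ 0 → evalPt h B = 0 := by
    intro B h1 h2
    rw [hgh, evalPt_mul] at h1
    exact (mul_eq_zero.mp h1).resolve_left h2
  -- m divides h
  have hhP : evalPt h P = 0 := by
    obtain ⟨T, hTc, hT⟩ := exists_points hm {P} (n + 1)
    obtain ⟨k, hk, -⟩ := line_dvd (p := h) hm T (fun B hB => (hT B hB).1) (by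
      intro B hB
      obtain ⟨h1, h2⟩ := hT B hB
      apply hzero
      · rw [hge]
        obtain ⟨u, rfl⟩ := hmp
        obtain ⟨v, rfl⟩ := hmp'
        rw [evalPt_mul, evalPt_mul, h1]; ring
      · intro h3
        rw [Finset.mem_singleton] at h2
        exact hαS D hDX hDlam (line_zero hm hα.1 h2 h1 hmP h3 hPα hmD)) (by omega)
    rw [hk, evalPt_mul, hmP, zero_mul]
  -- β divides h
  obtain ⟨k, hhk, hkd⟩ := line_dvd (p := h) hβ.1 (nodesOn (X \ nodesOn X lam) β)
    (fun B hB => (mem_nodesOn.mp hB).2)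
    (by
      intro B hB
      obtain ⟨hB1, hB2⟩ := mem_nodesOn.mp hB
      obtain ⟨h1, h2⟩ := mem_offLine.mp hB1
      by_cases hBP : B = P
      · rw [hBP, hhP]
      · apply hzero
        · exact hgz B h1 (fun e => h2 (e ▸ hclam)) (fun e => h2 (e ▸ hclam'))
        · intro h3
          exact hQβ (line_zero hα.1 hβ.1 hBP h3 hPα hB2 hPβ hQα))
    (by rw [hβ.2]; omega)
  by_cases hk0 : k = 0
  · intro E _
    rw [hgh, hhk, hk0]; simp [evalPt_zero]
  have hkd' : k.totalDegree + 1 ≤ h.totalDegree := hkd.resolve_left hk0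
  have hcard : (((nodesOn X lam).erase c).erase c').card = n := by
    rw [Finset.card_erase_of_mem, Finset.card_erase_of_mem hc, hlam.2]
    · omega
    · exact Finset.mem_erase.mpr ⟨hcc.symm, hc'⟩
  obtain ⟨r, hkr, -⟩ := line_dvd (p := k) hlam.1 (((nodesOn X lam).erase c).erase c')
    (by
      intro B hB
      simp only [Finset.mem_erase, mem_nodesOn] at hB
      exact hB.2.2.2)
    (by
      intro B hB
      simp only [Finset.mem_erase, mem_nodesOn] at hB
      have h1 := hzero B (hgz B hB.2.2.1 hB.2.1 hB.1) (hαS B hB.2.2.1 hB.2.2.2)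
      rw [hhk, evalPt_mul] at h1
      exact (mul_eq_zero.mp h1).resolve_left (hβS B hB.2.2.1 hB.2.2.2))
    (by omega)
  intro E hE
  rw [hgh, hhk, hkr]
  simp [evalPt_mul, hE]

/-- Core contradiction in the inductive step of the existence of a maximal line avoiding
a given node. -/
lemma core_contra {n : ℕ} {X : Finset (ℝ × ℝ)} (h : GCs (n + 1) X) {lam α β γ : Poly2}
    (hlam : IsMaximalLine (n + 1) X lam)
    (hα : IsMaximalLine n (X \ nodesOn X lam) α) (hβ : IsMaximalLine n (X \ nodesOn X lam) β)
    (hγ : IsMaximalLine n (X \ nodesOn X lam) γ)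
    (hαS : ∀ B ∈ X, evalPt lam B = 0 → evalPt α B ≠ 0)
    (hβS : ∀ B ∈ X, evalPt lam B = 0 → evalPt β B ≠ 0)
    (hγS : (∀ B ∈ X, evalPt lam B = 0 → evalPt γ B ≠ 0) ∨
      (IsMaximalLine (n + 1) X γ ∧ ∃ A ∈ nodesOn X lam, evalPt γ A = 0))
    {P Q : ℝ × ℝ} (hPX : P ∈ X) (hPlam : evalPt lam P ≠ 0) (hPα : evalPt α P = 0)
    (hPβ : evalPt β P = 0) (hPγ : evalPt γ P ≠ 0)
    (hQα : evalPt α Q = 0) (hQβ : evalPt β Q ≠ 0) : False := by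
  have key : ∀ c ∈ nodesOn X lam, ∃ m : Poly2, ∃ D N : ℝ × ℝ, m.totalDegree = 1 ∧ evalPt m P = 0 ∧
      D ∈ nodesOn X lam ∧ evalPt m D = 0 ∧
      (∃ p : Poly2, p.totalDegree ≤ n + 1 ∧ evalPt p c ≠ 0 ∧ (∀ B ∈ X, B ≠ c → evalPt p B = 0) ∧
        m ∣ p) ∧
      ((∀ B ∈ X, evalPt lam B = 0 → evalPt γ B ≠ 0) →
        N ∈ nodesOn (X \ nodesOn X lam) γ ∧ evalPt m N = 0) ∧
      (IsMaximalLine (n + 1) X γ → ∀ A ∈ nodesOn X lam, evalPt γ A = 0 → D ≠ A) := by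
    intro c hc
    obtain ⟨hcX, hcl⟩ := mem_nodesOn.mp hc
    obtain ⟨f, hf, hfc, hfB⟩ := h.lines c hcX
    have hPc : P ≠ c := fun e => hPlam (e ▸ hcl)
    obtain ⟨i, hi⟩ := hfB P hPX hPc
    obtain ⟨hm1, hm2⟩ := line_match hf hlam.1 (T := (nodesOn X lam).erase c)
      (fun t ht => (mem_nodesOn.mp (Finset.mem_of_mem_erase ht)).2)
      (fun t ht => hfB t (mem_nodesOn.mp (Finset.mem_of_mem_erase ht)).1 (Finset.ne_of_mem_erase ht))
      (by rw [Finset.card_erase_of_mem hc, hlam.2]; rfl) (fun j => ⟨c, hcl, hfc j⟩)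
    obtain ⟨D, hD, hDi⟩ := hm1 i
    have hN : ∃ N, (∀ B ∈ X, evalPt lam B = 0 → evalPt γ B ≠ 0) →
        N ∈ nodesOn (X \ nodesOn X lam) γ ∧ evalPt (f i) N = 0 := by
      by_cases hmiss : ∀ B ∈ X, evalPt lam B = 0 → evalPt γ B ≠ 0
      · have := (line_match hf hγ.1 (T := nodesOn (X \ nodesOn X lam) γ)
          (fun t ht => (mem_nodesOn.mp ht).2)
          (fun t ht => hfB t (mem_offLine.mp (mem_nodesOn.mp ht).1).1
            (fun e => (mem_offLine.mp (mem_nodesOn.mp ht).1).2 (e ▸ hcl)))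
          hγ.2 (fun j => by
            by_contra hcon
            push Not at hcon
            obtain ⟨T, hT, hTz⟩ := exists_points hγ.1 ∅ 2
            obtain ⟨a, b, hab, rfl⟩ := Finset.card_eq_two.mp hT
            obtain ⟨t, ht, htj⟩ := hm1 j
            have ha := (hTz a (by simp)).1
            have hb := (hTz b (by simp)).1
            obtain ⟨htX, htl⟩ := mem_nodesOn.mp (Finset.mem_of_mem_erase ht)
            exact hmiss t htX htl (line_zero (hf j) hγ.1 hab (hcon a ha) (hcon b hb) ha hb htj))).1 i
        obtain ⟨N, hN, hNi⟩ := this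
        exact ⟨N, fun _ => ⟨hN, hNi⟩⟩
      · exact ⟨P, fun hh => absurd hh hmiss⟩
    obtain ⟨N, hN⟩ := hN
    refine ⟨f i, D, N, hf i, hi, Finset.mem_of_mem_erase hD, hDi,
      ⟨∏ j, f j, by simpa using totalDegree_prod_lines Finset.univ f (fun j _ => hf j), ?_, ?_,
        Finset.dvd_prod_of_mem f (Finset.mem_univ i)⟩, hN, ?_⟩
    · rw [evalPt_prod]
      exact Finset.prod_ne_zero_iff.mpr (fun j _ => hfc j)
    · intro B hB hBc
      obtain ⟨j, hj⟩ := hfB B hB hBc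
      rw [evalPt_prod]
      exact Finset.prod_eq_zero (Finset.mem_univ j) hj
    · intro hγX A hA hγA hDA
      obtain ⟨hAX, hAl⟩ := mem_nodesOn.mp hA
      have hAc : A ≠ c := fun e => Finset.ne_of_mem_erase hD (hDA.trans e)
      have hγc : evalPt γ c ≠ 0 := by
        intro h0
        obtain ⟨R, hR⟩ : (nodesOn (X \ nodesOn X lam) γ).Nonempty :=
          Finset.card_pos.mp (by rw [hγ.2]; omega)
        obtain ⟨hR1, hR2⟩ := mem_nodesOn.mp hR
        exact (mem_offLine.mp hR1).2 (line_zero hγ.1 hlam.1 hAc hγA h0 hAl hcl hR2)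
      obtain ⟨j, k, hk, hj⟩ := line_mem hf hγ.1 (T := nodesOn X γ)
        (fun t ht => (mem_nodesOn.mp ht).2)
        (fun t ht => hfB t (mem_nodesOn.mp ht).1 (fun e => hγc (e ▸ (mem_nodesOn.mp ht).2)))
        (by rw [hγX.2]; omega)
      have hij : i = j := hm2 D hD i j hDi (by rw [hj, evalPt_mul, hDA, hγA, zero_mul])
      rw [hij, hj, evalPt_mul, evalPt_C] at hi
      exact (mul_ne_zero hPγ hk) hi
  choose! m D N hm hmP hDS hmD hp hN hDA using key
  have inj : ∀ c ∈ nodesOn X lam, ∀ c' ∈ nodesOn X lam, ∀ R, R ≠ P → evalPt (m c) R = 0 →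
      evalPt (m c') R = 0 → c = c' := by
    intro c hc c' hc' R hRP h1 h2
    by_contra hcc
    obtain ⟨k, hk, hkk⟩ := line_eq (hm c' hc') (hm c hc) hRP h2 (hmP c' hc') h1 (hmP c hc)
    obtain ⟨p, hp1, hp2, hp3, hp4⟩ := hp c hc
    obtain ⟨p', hp1', hp2', hp3', hp4'⟩ := hp c' hc'
    obtain ⟨hDX, hDl⟩ := mem_nodesOn.mp (hDS c' hc')
    exact factor_inj hlam hα hβ hαS hβS hPα hQα hQβ hPβ (hm c' hc') (hmP c' hc') (hmD c' hc')
      hDX hDl hc hc' hcc hp1 hp1' hp2 hp2' hp3 hp3'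
      ((Dvd.intro _ hkk.symm).trans hp4) hp4'
  rcases hγS with hmiss | ⟨hγX, A, hA, hγA⟩
  · have := Finset.card_le_card_of_injOn (s := nodesOn X lam)
      (t := nodesOn (X \ nodesOn X lam) γ) N (fun c hc => (hN c hc hmiss).1)
      (fun c hc c' hc' e => inj c hc c' hc' (N c)
        (fun e' => hPγ (e' ▸ (mem_nodesOn.mp (hN c hc hmiss).1).2)) (hN c hc hmiss).2
        (e ▸ (hN c' hc' hmiss).2))
    rw [hlam.2, hγ.2] at this
    omega
  · have := Finset.card_le_card_of_injOn (s := nodesOn X lam)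
      (t := (nodesOn X lam).erase A) D
      (fun c hc => Finset.mem_erase.mpr ⟨hDA c hc hγX A hA hγA, hDS c hc⟩)
      (fun c hc c' hc' e => inj c hc c' hc' (D c)
        (fun e' => hPlam (e' ▸ (mem_nodesOn.mp (hDS c hc)).2)) (hmD c hc)
        (e ▸ hmD c' hc'))
    rw [Finset.card_erase_of_mem hA, hlam.2] at this
    omega

lemma three_lines {n : ℕ} {Y : Finset (ℝ × ℝ)} (h : GCs (n + 1) Y)
    (hP : ∀ A ∈ Y, ∃ lam, IsMaximalLine (n + 1) Y lam ∧ evalPt lam A ≠ 0) :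
    ∃ α β γ, IsMaximalLine (n + 1) Y α ∧ IsMaximalLine (n + 1) Y β ∧ IsMaximalLine (n + 1) Y γ ∧
      (∃ P ∈ Y, evalPt α P = 0 ∧ evalPt β P = 0 ∧ evalPt γ P ≠ 0) ∧
      (∃ P ∈ Y, evalPt α P = 0 ∧ evalPt γ P = 0 ∧ evalPt β P ≠ 0) ∧
      (∃ P ∈ Y, evalPt β P = 0 ∧ evalPt γ P = 0 ∧ evalPt α P ≠ 0) := by
  obtain ⟨A, hA⟩ : Y.Nonempty := Finset.card_pos.mp (by
    rw [h.card]; exact Nat.choose_pos (by omega))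
  obtain ⟨α, hα, -⟩ := hP A hA
  obtain ⟨Q, hQ⟩ : (nodesOn Y α).Nonempty := Finset.card_pos.mp (by rw [hα.2]; omega)
  obtain ⟨hQY, hQα⟩ := mem_nodesOn.mp hQ
  obtain ⟨β, hβ, hβQ⟩ := hP Q hQY
  obtain ⟨P, hPY, hPα, hPβ⟩ := h.maximal_meet hα hβ
  obtain ⟨γ, hγ, hγP⟩ := hP P hPY
  obtain ⟨P1, hP1, h11, h12⟩ := h.maximal_meet hα hγ
  obtain ⟨P2, hP2, h21, h22⟩ := h.maximal_meet hβ hγ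
  refine ⟨α, β, γ, hα, hβ, hγ, ⟨P, hPY, hPα, hPβ, hγP⟩, ⟨P1, hP1, h11, h12, fun h0 => ?_⟩,
    ⟨P2, hP2, h21, h22, fun h0 => ?_⟩⟩
  · exact hβQ (line_zero hα.1 hβ.1 (fun e => hγP (e ▸ h12) : P1 ≠ P) h11 hPα h0 hPβ hQα)
  · exact hβQ (line_zero hα.1 hβ.1 (fun e => hγP (e ▸ h22) : P2 ≠ P) h0 hPα h21 hPβ hQα)

/-- Under GM, no node lies on all maximal lines. -/
lemma exists_maximal_avoid (n : ℕ) : (∀ m ≤ n + 1, GM m) → ∀ X : Finset (ℝ × ℝ), GCs (n + 1) X →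
    ∀ A ∈ X, ∃ lam, IsMaximalLine (n + 1) X lam ∧ evalPt lam A ≠ 0 := by
  induction n with
  | zero =>
    intro _ X h A hA
    have hc : (X.erase A).card = 2 := by
      rw [Finset.card_erase_of_mem hA, h.card]; rfl
    obtain ⟨B, E, hBE, hs⟩ := Finset.card_eq_two.mp hc
    obtain ⟨f, hf, hfB, hfE⟩ := exists_line hBE
    have hB : B ∈ X.erase A := by rw [hs]; simp
    have hE : E ∈ X.erase A := by rw [hs]; simp
    have hsub : ({B, E} : Finset (ℝ × ℝ)) ⊆ nodesOn X f := by
      intro Z hZ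
      simp only [Finset.mem_insert, Finset.mem_singleton] at hZ
      rcases hZ with rfl | rfl
      · exact mem_nodesOn.mpr ⟨Finset.mem_of_mem_erase hB, hfB⟩
      · exact mem_nodesOn.mpr ⟨Finset.mem_of_mem_erase hE, hfE⟩
    have h1 := Finset.card_le_card hsub
    rw [Finset.card_pair hBE] at h1
    have h2 := h.card_line_le hf
    refine ⟨f, ⟨hf, by omega⟩, fun h0 => ?_⟩
    have : X ⊆ nodesOn X f := by
      intro Z hZ
      by_cases hZA : Z = A
      · exact mem_nodesOn.mpr ⟨hZ, hZA ▸ h0⟩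
      · exact hsub (hs ▸ Finset.mem_erase.mpr ⟨hZA, hZ⟩)
    have h3 := Finset.card_le_card this
    rw [h.card] at h3
    have : (0 + 1 + 2).choose 2 = 3 := rfl
    omega
  | succ n ih =>
    intro hGM X h A hA
    obtain ⟨lam, hlam⟩ := hGM _ le_rfl X h.isGC
    by_contra hcon
    push Not at hcon
    have hAl := hcon lam hlam
    have hY := h.remove hlam
    obtain ⟨α, β, γ, hα, hβ, hγ, ⟨P, hP, hP1, hP2, hP3⟩, ⟨Q, hQ, hQ1, hQ2, hQ3⟩,
      ⟨R, hR, hR1, hR2, hR3⟩⟩ := three_lines hY (ih (fun m hm => hGM m (by omega)) _ hY)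
    have hmax : ∀ σ, IsMaximalLine (n + 1) (X \ nodesOn X lam) σ →
        (∀ B ∈ X, evalPt lam B = 0 → evalPt σ B ≠ 0) ∨
        (IsMaximalLine (n + 1 + 1) X σ ∧ ∃ A ∈ nodesOn X lam, evalPt σ A = 0) := by
      intro σ hσ
      by_cases hm : ∀ B ∈ X, evalPt lam B = 0 → evalPt σ B ≠ 0
      · exact Or.inl hm
      · push Not at hm
        obtain ⟨B, hB, hBl, hBσ⟩ := hm
        refine Or.inr ⟨⟨hσ.1, ?_⟩, B, mem_nodesOn.mpr ⟨hB, hBl⟩, hBσ⟩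
        have h1 := h.card_line_le hσ.1
        have h2 : insert B (nodesOn (X \ nodesOn X lam) σ) ⊆ nodesOn X σ := by
          intro Z hZ
          rcases Finset.mem_insert.mp hZ with rfl | hZ
          · exact mem_nodesOn.mpr ⟨hB, hBσ⟩
          · obtain ⟨h3, h4⟩ := mem_nodesOn.mp hZ
            exact mem_nodesOn.mpr ⟨(mem_offLine.mp h3).1, h4⟩
        have h3 := Finset.card_le_card h2
        rw [Finset.card_insert_of_notMem
          (fun h4 => (mem_offLine.mp (mem_nodesOn.mp h4).1).2 hBl), hσ.2] at h3
        omega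
    have hA' : ∀ Z ∈ X \ nodesOn X lam, Z ≠ A := fun Z hZ e => (mem_offLine.mp hZ).2 (e ▸ hAl)
    have two : ∀ σ τ, IsMaximalLine (n + 1 + 1) X σ → IsMaximalLine (n + 1 + 1) X τ →
        ∀ U ∈ X \ nodesOn X lam, evalPt σ U = 0 → evalPt τ U = 0 →
        ∀ V, evalPt σ V = 0 → evalPt τ V ≠ 0 → False := by
      intro σ τ hσ hτ U hU h1 h2 V h3 h4
      exact h4 (line_zero hσ.1 hτ.1 (hA' U hU) h1 (hcon σ hσ) h2 (hcon τ hτ) h3)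
    obtain ⟨hPX, hPl⟩ := mem_offLine.mp hP
    obtain ⟨hQX, hQl⟩ := mem_offLine.mp hQ
    obtain ⟨hRX, hRl⟩ := mem_offLine.mp hR
    rcases hmax α hα with ha | ha
    · rcases hmax β hβ with hb | hb
      · exact core_contra h hlam hα hβ hγ ha hb (hmax γ hγ) hPX hPl hP1 hP2 hP3 hQ1 hQ3
      · rcases hmax γ hγ with hc | hc
        · exact core_contra h hlam hα hγ hβ ha hc (hmax β hβ) hQX hQl hQ1 hQ2 hQ3 hP1 hP3
        · exact two β γ hb.1 hc.1 R hR hR1 hR2 P hP2 hP3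
    · rcases hmax β hβ with hb | hb
      · rcases hmax γ hγ with hc | hc
        · exact core_contra h hlam hβ hγ hα hb hc (hmax α hα) hRX hRl hR1 hR2 hR3 hP2 hP3
        · exact two α γ ha.1 hc.1 Q hQ hQ1 hQ2 P hP1 hP3
      · exact two α β ha.1 hb.1 P hP hP1 hP2 Q hQ1 hQ3

lemma exists_off {σ τ : Poly2} (hσ : σ.totalDegree = 1) (hτ : τ.totalDegree = 1)
    (h : zeroSet σ ≠ zeroSet τ) : ∃ Q, evalPt σ Q = 0 ∧ evalPt τ Q ≠ 0 := by
  by_contra hcon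
  push Not at hcon
  apply h
  obtain ⟨T, hT, hTz⟩ := exists_points hσ ∅ 2
  obtain ⟨a, b, hab, rfl⟩ := Finset.card_eq_two.mp hT
  have ha := (hTz a (by simp)).1
  have hb := (hTz b (by simp)).1
  ext Z
  exact ⟨fun hZ => hcon Z hZ, fun hZ => line_zero hτ hσ hab (hcon a ha) (hcon b hb) ha hb hZ⟩

lemma off_symm {σ τ : Poly2} (hσ : σ.totalDegree = 1) (hτ : τ.totalDegree = 1)
    (h : ∃ Q, evalPt σ Q = 0 ∧ evalPt τ Q ≠ 0) : ∃ Q, evalPt τ Q = 0 ∧ evalPt σ Q ≠ 0 := by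
  obtain ⟨Q, h1, h2⟩ := h
  refine exists_off hτ hσ (fun e => h2 ?_)
  have : Q ∈ zeroSet τ := by rw [e]; exact h1
  exact this

/-- Two distinct lines share at most one point. -/
lemma meet_unique {σ τ : Poly2} (hσ : σ.totalDegree = 1) (hτ : τ.totalDegree = 1)
    (h : ∃ Q, evalPt σ Q = 0 ∧ evalPt τ Q ≠ 0) {A B : ℝ × ℝ} (h1 : evalPt σ A = 0)
    (h2 : evalPt τ A = 0) (h3 : evalPt σ B = 0) (h4 : evalPt τ B = 0) : A = B := by
  by_contra hne
  obtain ⟨Q, hQ1, hQ2⟩ := h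
  exact hQ2 (line_zero hσ hτ hne h1 h3 h2 h4 hQ1)

lemma uses_q {n : ℕ} {X : Finset (ℝ × ℝ)} {ℓ : Poly2} {A : ℝ × ℝ} (hℓ : ℓ.totalDegree = 1)
    (h : Uses (n + 1) X ℓ A) : evalPt ℓ A ≠ 0 ∧ ∃ q : Poly2, q.totalDegree ≤ n ∧ evalPt q A ≠ 0 ∧
      ∀ B ∈ X, evalPt ℓ B ≠ 0 → B ≠ A → evalPt q B = 0 := by
  obtain ⟨p, ⟨hp1, hp2, hp3⟩, q, rfl⟩ := h
  rw [evalPt_mul] at hp2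
  have hqA : evalPt q A ≠ 0 := fun h0 => by rw [h0, mul_zero] at hp2; exact zero_ne_one hp2
  have hq0 : q ≠ 0 := fun h0 => hqA (by rw [h0, evalPt_zero])
  rw [totalDegree_mul_line hℓ hq0] at hp1
  refine ⟨fun h0 => by rw [h0, zero_mul] at hp2; exact zero_ne_one hp2, q, by omega, hqA, ?_⟩
  intro B hB h1 h2
  have := hp3 B hB h2
  rw [evalPt_mul] at this
  exact (mul_eq_zero.mp this).resolve_left h1

lemma uses_of {n : ℕ} {X : Finset (ℝ × ℝ)} {ℓ p : Poly2} {A : ℝ × ℝ}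
    (hp : p.totalDegree ≤ n) (hA : evalPt p A ≠ 0) (hB : ∀ B ∈ X, B ≠ A → evalPt p B = 0)
    (hd : ℓ ∣ p) : Uses n X ℓ A := by
  refine ⟨C (evalPt p A)⁻¹ * p, ⟨?_, ?_, ?_⟩, hd.mul_left _⟩
  · rw [totalDegree_C_mul (inv_ne_zero hA)]; exact hp
  · rw [evalPt_mul, evalPt_C, inv_mul_cancel₀ hA]
  · intro B hBX hBA
    rw [evalPt_mul, hB B hBX hBA, mul_zero]

lemma mem_usesSet {n : ℕ} {X : Finset (ℝ × ℝ)} {ℓ : Poly2} {A : ℝ × ℝ} :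
    A ∈ usesSet n X ℓ ↔ A ∈ X ∧ Uses n X ℓ A := by
  simp [usesSet]

lemma part1_set {n : ℕ} {X : Finset (ℝ × ℝ)} (h : GCs (n + 1) X) {ℓ lam : Poly2}
    (hℓ : IsKNodeLine X ℓ (n + 1)) (hlam : IsMaximalLine (n + 1) X lam)
    (hd : ∀ A ∈ X, ¬(evalPt lam A = 0 ∧ evalPt ℓ A = 0)) :
    usesSet (n + 1) X ℓ = (X \ nodesOn X lam) \ nodesOn X ℓ := by
  ext A
  rw [mem_usesSet]
  constructor
  · rintro ⟨hAX, hU⟩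
    obtain ⟨hAl, q, hq, hqA, hqB⟩ := uses_q hℓ.1 hU
    refine Finset.mem_sdiff.mpr ⟨mem_offLine.mpr ⟨hAX, fun h0 => ?_⟩,
      fun h0 => hAl (mem_nodesOn.mp h0).2⟩
    have hAmem : A ∈ nodesOn X lam := mem_nodesOn.mpr ⟨hAX, h0⟩
    obtain ⟨r, hr, -⟩ := line_dvd (f := lam) (p := q) hlam.1 ((nodesOn X lam).erase A)
      (fun B hB => (mem_nodesOn.mp (Finset.mem_of_mem_erase hB)).2)
      (fun B hB => by
        obtain ⟨hBX, hBl⟩ := mem_nodesOn.mp (Finset.mem_of_mem_erase hB)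
        exact hqB B hBX (fun h1 => hd B hBX ⟨hBl, h1⟩) (Finset.ne_of_mem_erase hB))
      (by rw [Finset.card_erase_of_mem hAmem, hlam.2]; omega)
    rw [hr, evalPt_mul, h0, zero_mul] at hqA
    exact hqA rfl
  · intro hA
    obtain ⟨hA1, hA2⟩ := Finset.mem_sdiff.mp hA
    obtain ⟨hAX, hAlam⟩ := mem_offLine.mp hA1
    have hAl : evalPt ℓ A ≠ 0 := fun h0 => hA2 (mem_nodesOn.mpr ⟨hAX, h0⟩)
    refine ⟨hAX, ?_⟩
    obtain ⟨f, hf, hfA, hfB⟩ := (h.remove hlam).lines A hA1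
    obtain ⟨i, c, hc, hi⟩ := line_mem hf hℓ.1 (T := nodesOn X ℓ)
      (fun t ht => (mem_nodesOn.mp ht).2)
      (fun t ht => by
        obtain ⟨htX, htl⟩ := mem_nodesOn.mp ht
        exact hfB t (mem_offLine.mpr ⟨htX, fun h0 => hd t htX ⟨h0, htl⟩⟩)
          (fun e => hAl (e ▸ htl)))
      (by rw [hℓ.2]; omega)
    refine uses_of (p := lam * ∏ j, f j) ?_ ?_ ?_ ?_
    · refine (totalDegree_mul _ _).trans ?_
      have := totalDegree_prod_lines Finset.univ f (fun j _ => hf j)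
      rw [Finset.card_univ, Fintype.card_fin] at this
      rw [hlam.1]
      omega
    · rw [evalPt_mul, evalPt_prod]
      exact mul_ne_zero hAlam (Finset.prod_ne_zero_iff.mpr (fun j _ => hfA j))
    · intro B hB hBA
      rw [evalPt_mul, evalPt_prod]
      by_cases hBl : evalPt lam B = 0
      · rw [hBl, zero_mul]
      · obtain ⟨j, hj⟩ := hfB B (mem_offLine.mpr ⟨hB, hBl⟩) hBA
        rw [Finset.prod_eq_zero (Finset.mem_univ j) hj, mul_zero]
    · refine Dvd.dvd.mul_left ?_ _
      exact (Dvd.intro _ hi.symm).trans (Finset.dvd_prod_of_mem f (Finset.mem_univ i))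

lemma part1_card {n : ℕ} {X : Finset (ℝ × ℝ)} (h : GCs (n + 1) X) {ℓ lam : Poly2}
    (hℓ : IsKNodeLine X ℓ (n + 1)) (hlam : IsMaximalLine (n + 1) X lam)
    (hd : ∀ A ∈ X, ¬(evalPt lam A = 0 ∧ evalPt ℓ A = 0)) :
    (usesSet (n + 1) X ℓ).card = (n + 1).choose 2 := by
  rw [part1_set h hℓ hlam hd]
  have h1 : nodesOn X ℓ ⊆ X \ nodesOn X lam := by
    intro A hA
    obtain ⟨hAX, hAl⟩ := mem_nodesOn.mp hA
    exact mem_offLine.mpr ⟨hAX, fun h0 => hd A hAX ⟨h0, hAl⟩⟩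
  have h2 := Finset.card_sdiff_add_card_eq_card h1
  rw [hℓ.2, (h.remove hlam).card] at h2
  have h3 := choose_step n
  have h4 : n + 2 = n + 1 + 1 := rfl
  rw [h4] at h2
  omega

/-- The number of nodes of a line after removal of a line meeting it at a node. -/
lemma maximal_remove {X : Finset (ℝ × ℝ)} {σ τ : Poly2} {k : ℕ}
    (hσ : σ.totalDegree = 1) (hτ : IsKNodeLine X τ (k + 1))
    (hne : ∃ Q, evalPt σ Q = 0 ∧ evalPt τ Q ≠ 0) {A : ℝ × ℝ} (hA : A ∈ X)
    (h1 : evalPt σ A = 0) (h2 : evalPt τ A = 0) : IsKNodeLine (X \ nodesOn X σ) τ k := by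
  refine ⟨hτ.1, ?_⟩
  have : nodesOn (X \ nodesOn X σ) τ = (nodesOn X τ).erase A := by
    ext B
    simp only [mem_nodesOn, mem_offLine, Finset.mem_erase]
    constructor
    · rintro ⟨⟨h3, h4⟩, h5⟩
      exact ⟨fun e => h4 (e ▸ h1), h3, h5⟩
    · rintro ⟨h3, h4, h5⟩
      exact ⟨⟨h4, fun h6 => h3 (meet_unique hσ hτ.1 hne h6 h5 h1 h2)⟩, h5⟩
  rw [this, Finset.card_erase_of_mem (mem_nodesOn.mpr ⟨hA, h2⟩), hτ.2]
  rfl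

lemma knode_ne {X : Finset (ℝ × ℝ)} {σ τ : Poly2} {k l : ℕ} (hσ : IsKNodeLine X σ k)
    (hτ : IsKNodeLine X τ l) (hkl : k ≠ l) : ∃ Q, evalPt σ Q = 0 ∧ evalPt τ Q ≠ 0 := by
  refine exists_off hσ.1 hτ.1 (fun e => hkl ?_)
  rw [← hσ.2, ← hτ.2]
  congr 1
  ext B
  have : B ∈ zeroSet σ ↔ B ∈ zeroSet τ := by rw [e]
  simp only [mem_nodesOn]
  exact and_congr_right (fun _ => this)

lemma part2_aux {n : ℕ} {X : Finset (ℝ × ℝ)} {ℓ σ τ : Poly2}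
    (hℓ : IsKNodeLine X ℓ (n + 1)) (hσ : IsMaximalLine (n + 1) X σ)
    (hτ : IsMaximalLine (n + 1) X τ) (hne : ∃ Q, evalPt σ Q = 0 ∧ evalPt τ Q ≠ 0)
    {a : ℝ × ℝ} (ha : a ∈ X) (h1 : evalPt σ a = 0) (h2 : evalPt τ a = 0) (h3 : evalPt ℓ a = 0)
    {A : ℝ × ℝ} (hAX : A ∈ X) (hU : Uses (n + 1) X ℓ A) : evalPt σ A ≠ 0 := by
  intro h0
  obtain ⟨hAl, q, hq, hqA, hqB⟩ := uses_q hℓ.1 hU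
  have haA : a ≠ A := fun e => hAl (e ▸ h3)
  have hτA : evalPt τ A ≠ 0 := fun h4 => haA (meet_unique hσ.1 hτ.1 hne h1 h2 h0 h4)
  have hτℓ := knode_ne hτ hℓ (by omega)
  have hσℓ := knode_ne hσ hℓ (by omega)
  have hτ' : (nodesOn X τ).card = n + 1 + 1 := hτ.2
  have hσ' : (nodesOn X σ).card = n + 1 + 1 := hσ.2
  obtain ⟨r, hr, hrd⟩ := line_dvd (f := τ) (p := q) hτ.1 ((nodesOn X τ).erase a)
    (fun B hB => (mem_nodesOn.mp (Finset.mem_of_mem_erase hB)).2)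
    (fun B hB => by
      obtain ⟨hBX, hBl⟩ := mem_nodesOn.mp (Finset.mem_of_mem_erase hB)
      exact hqB B hBX
        (fun h4 => Finset.ne_of_mem_erase hB (meet_unique hτ.1 hℓ.1 hτℓ hBl h4 h2 h3))
        (fun e => hτA (e ▸ hBl)))
    (by rw [Finset.card_erase_of_mem (mem_nodesOn.mpr ⟨ha, h2⟩), hτ']; omega)
  have hrA : evalPt r A ≠ 0 := fun h4 => hqA (by rw [hr, evalPt_mul, h4, mul_zero])
  have hrd' : r.totalDegree + 1 ≤ n := by
    rcases hrd with h4 | h4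
    · exact absurd (by rw [h4, evalPt_zero]) hrA
    · omega
  obtain ⟨s, hs, -⟩ := line_dvd (f := σ) (p := r) hσ.1 (((nodesOn X σ).erase a).erase A)
    (fun B hB => (mem_nodesOn.mp (Finset.mem_of_mem_erase (Finset.mem_of_mem_erase hB))).2)
    (fun B hB => by
      have hBa := Finset.ne_of_mem_erase (Finset.mem_of_mem_erase hB)
      obtain ⟨hBX, hBl⟩ := mem_nodesOn.mp (Finset.mem_of_mem_erase (Finset.mem_of_mem_erase hB))
      have h5 := hqB B hBX (fun h4 => hBa (meet_unique hσ.1 hℓ.1 hσℓ hBl h4 h1 h3))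
        (Finset.ne_of_mem_erase hB)
      rw [hr, evalPt_mul] at h5
      exact (mul_eq_zero.mp h5).resolve_left
        (fun h4 => hBa (meet_unique hσ.1 hτ.1 hne hBl h4 h1 h2)))
    (by
      rw [Finset.card_erase_of_mem (Finset.mem_erase.mpr ⟨haA.symm, mem_nodesOn.mpr ⟨hAX, h0⟩⟩),
        Finset.card_erase_of_mem (mem_nodesOn.mpr ⟨ha, h1⟩), hσ']
      omega)
  rw [hs, evalPt_mul, h0, zero_mul] at hrA
  exact hrA rfl

lemma mem_rest {X : Finset (ℝ × ℝ)} {ℓ σ τ : Poly2} {A : ℝ × ℝ} :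
    A ∈ ((X \ nodesOn X σ) \ nodesOn X τ) \ nodesOn X ℓ ↔
      A ∈ X ∧ evalPt σ A ≠ 0 ∧ evalPt τ A ≠ 0 ∧ evalPt ℓ A ≠ 0 := by
  simp only [Finset.mem_sdiff, mem_nodesOn]
  tauto

lemma sdiff_nodesOn {X : Finset (ℝ × ℝ)} {σ τ : Poly2} :
    (X \ nodesOn X σ) \ nodesOn X τ = (X \ nodesOn X σ) \ nodesOn (X \ nodesOn X σ) τ := by
  ext A
  simp only [Finset.mem_sdiff, mem_nodesOn]
  tauto

lemma part2_set {n : ℕ} {X : Finset (ℝ × ℝ)} (h : GCs (n + 1) X) {ℓ σ τ : Poly2}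
    (hℓ : IsKNodeLine X ℓ (n + 1)) (hσ : IsMaximalLine (n + 1) X σ)
    (hτ : IsMaximalLine (n + 1) X τ) (hne : ∃ Q, evalPt σ Q = 0 ∧ evalPt τ Q ≠ 0)
    {a : ℝ × ℝ} (ha : a ∈ X) (h1 : evalPt σ a = 0) (h2 : evalPt τ a = 0) (h3 : evalPt ℓ a = 0) :
    usesSet (n + 1) X ℓ = ((X \ nodesOn X σ) \ nodesOn X τ) \ nodesOn X ℓ ∧
    (usesSet (n + 1) X ℓ).card = n.choose 2 := by
  have hY := h.remove hσ
  have hτY : IsMaximalLine n (X \ nodesOn X σ) τ := maximal_remove hσ.1 hτ hne ha h1 h2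
  have hℓY : IsKNodeLine (X \ nodesOn X σ) ℓ n :=
    maximal_remove hσ.1 hℓ (knode_ne hσ hℓ (by omega)) ha h1 h3
  have hsub : ∀ A ∈ usesSet (n + 1) X ℓ,
      A ∈ ((X \ nodesOn X σ) \ nodesOn X τ) \ nodesOn X ℓ := by
    intro A hA
    obtain ⟨hAX, hU⟩ := mem_usesSet.mp hA
    exact mem_rest.mpr ⟨hAX, part2_aux hℓ hσ hτ hne ha h1 h2 h3 hAX hU,
      part2_aux hℓ hτ hσ (off_symm hσ.1 hτ.1 hne) ha h2 h1 h3 hAX hU, (uses_q hℓ.1 hU).1⟩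
  cases n with
  | zero =>
    have hc := card_offLine (X \ nodesOn X σ) τ
    rw [hτY.2, hY.card, ← sdiff_nodesOn] at hc
    have hc0 : ((X \ nodesOn X σ) \ nodesOn X τ) = ∅ := by
      rw [← Finset.card_eq_zero]
      have : (0 + 2).choose 2 = 1 := rfl
      omega
    rw [hc0] at hsub ⊢
    simp only [Finset.empty_sdiff, Finset.notMem_empty] at hsub ⊢
    have : usesSet (0 + 1) X ℓ = ∅ := Finset.eq_empty_of_forall_notMem hsub
    rw [this]
    simp
  | succ k =>
    have hZ := hY.remove hτY
    have hcard := card_offLine (X \ nodesOn X σ) τ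
    -- nodes of ℓ in the rest
    have hℓZ : (nodesOn ((X \ nodesOn X σ) \ nodesOn (X \ nodesOn X σ) τ) ℓ).card = k + 1 := by
      rw [← hℓY.2]
      congr 1
      ext B
      simp only [mem_nodesOn, mem_offLine]
      constructor
      · rintro ⟨⟨h4, -⟩, h5⟩
        exact ⟨h4, h5⟩
      · rintro ⟨h4, h5⟩
        refine ⟨⟨h4, fun h6 => ?_⟩, h5⟩
        have := meet_unique hτ.1 hℓ.1 (knode_ne hτ hℓ (by omega)) h6 h5 h2 h3
        exact h4.2 (this ▸ h1)
    have hset : usesSet (k + 1 + 1) X ℓ = ((X \ nodesOn X σ) \ nodesOn X τ) \ nodesOn X ℓ := by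
      ext A
      refine ⟨hsub A, fun hA => ?_⟩
      obtain ⟨hAX, hAσ, hAτ, hAl⟩ := mem_rest.mp hA
      refine mem_usesSet.mpr ⟨hAX, ?_⟩
      obtain ⟨f, hf, hfA, hfB⟩ := hZ.lines A (mem_offLine.mpr ⟨mem_offLine.mpr ⟨hAX, hAσ⟩, hAτ⟩)
      obtain ⟨i, c, hc, hi⟩ := line_mem hf hℓ.1
        (T := nodesOn ((X \ nodesOn X σ) \ nodesOn (X \ nodesOn X σ) τ) ℓ)
        (fun t ht => (mem_nodesOn.mp ht).2)
        (fun t ht => hfB t (mem_nodesOn.mp ht).1 (fun e => hAl (e ▸ (mem_nodesOn.mp ht).2)))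
        (by rw [hℓZ]; omega)
      refine uses_of (p := σ * (τ * ∏ j, f j)) ?_ ?_ ?_ ?_
      · have := totalDegree_prod_lines Finset.univ f (fun j _ => hf j)
        rw [Finset.card_univ, Fintype.card_fin] at this
        have h4 := totalDegree_mul σ (τ * ∏ j, f j)
        have h5 := totalDegree_mul τ (∏ j, f j)
        rw [hσ.1] at h4
        rw [hτ.1] at h5
        omega
      · rw [evalPt_mul, evalPt_mul, evalPt_prod]
        exact mul_ne_zero hAσ (mul_ne_zero hAτ (Finset.prod_ne_zero_iff.mpr (fun j _ => hfA j)))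
      · intro B hB hBA
        rw [evalPt_mul, evalPt_mul, evalPt_prod]
        by_cases hBσ : evalPt σ B = 0
        · rw [hBσ, zero_mul]
        by_cases hBτ : evalPt τ B = 0
        · rw [hBτ, zero_mul, mul_zero]
        obtain ⟨j, hj⟩ := hfB B (mem_offLine.mpr ⟨mem_offLine.mpr ⟨hB, hBσ⟩, hBτ⟩) hBA
        rw [Finset.prod_eq_zero (Finset.mem_univ j) hj, mul_zero, mul_zero]
      · refine Dvd.dvd.mul_left (Dvd.dvd.mul_left ?_ _) _
        exact (Dvd.intro _ hi.symm).trans (Finset.dvd_prod_of_mem f (Finset.mem_univ i))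
    refine ⟨hset, ?_⟩
    have hset2 : usesSet (k + 1 + 1) X ℓ = ((X \ nodesOn X σ) \ nodesOn (X \ nodesOn X σ) τ) \
        nodesOn ((X \ nodesOn X σ) \ nodesOn (X \ nodesOn X σ) τ) ℓ := by
      rw [hset, ← sdiff_nodesOn]
      ext B
      simp only [Finset.mem_sdiff, mem_nodesOn]
      tauto
    have h4 := card_offLine ((X \ nodesOn X σ) \ nodesOn (X \ nodesOn X σ) τ) ℓ
    rw [← hset2, hℓZ, hZ.card] at h4
    have h5 := choose_step k
    have h6 : k + 2 = k + 1 + 1 := rfl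
    rw [h6] at h4
    omega

/-- Essential `d`-dependence of `T`: no node of `T` has a fundamental polynomial of degree `≤ d`. -/
def Dep (d : ℕ) (T : Finset (ℝ × ℝ)) : Prop :=
  ∀ q : Poly2, q.totalDegree ≤ d → ∀ B ∈ T, (∀ B' ∈ T, B' ≠ B → evalPt q B' = 0) → evalPt q B = 0

lemma Dep.remove {d : ℕ} {T : Finset (ℝ × ℝ)} (h : Dep (d + 1) T) {m : Poly2}
    (hm : m.totalDegree = 1) : Dep d (T \ nodesOn T m) := by
  intro q hq B hB hz
  obtain ⟨hBT, hBm⟩ := mem_offLine.mp hB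
  have h1 := h (m * q) ((totalDegree_mul _ _).trans (by omega)) B hBT (fun B' hB' hne => by
    rw [evalPt_mul]
    by_cases h0 : evalPt m B' = 0
    · rw [h0, zero_mul]
    · rw [hz B' (mem_offLine.mpr ⟨hB', h0⟩) hne, mul_zero])
  rw [evalPt_mul] at h1
  exact (mul_eq_zero.mp h1).resolve_left hBm

lemma Dep.card_ge {d : ℕ} {T : Finset (ℝ × ℝ)} (h : Dep d T) (hne : T.Nonempty) :
    d + 2 ≤ T.card := by
  by_contra hlt
  obtain ⟨B, hB⟩ := hne
  have key : ∀ B' ∈ T.erase B, ∃ f : Poly2, f.totalDegree = 1 ∧ evalPt f B' = 0 ∧ evalPt f B ≠ 0 :=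
    fun B' hB' => exists_line_avoid (Finset.ne_of_mem_erase hB')
  choose! f hf hf1 hf2 using key
  have h1 := totalDegree_prod_lines (T.erase B) f hf
  rw [Finset.card_erase_of_mem hB] at h1
  have h2 := h (∏ i ∈ T.erase B, f i) (by omega) B hB (fun B' hB' hne => by
    rw [evalPt_prod]
    have h3 := Finset.mem_erase.mpr ⟨hne, hB'⟩
    exact Finset.prod_eq_zero h3 (hf1 B' h3))
  rw [evalPt_prod] at h2
  exact (Finset.prod_ne_zero_iff.mpr hf2) h2

lemma Dep.exists_line {d : ℕ} : ∀ {T : Finset (ℝ × ℝ)}, Dep d T → T.Nonempty →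
    (T.card ≤ 2 * d + 1 ∨ T.card ≤ d + 2) →
    ∃ m : Poly2, m.totalDegree = 1 ∧ d + 2 ≤ (nodesOn T m).card := by
  induction d with
  | zero =>
    intro T h hne hc
    have h1 := h.card_ge hne
    obtain ⟨P, Q, hPQ, rfl⟩ := Finset.card_eq_two.mp (show T.card = 2 by omega)
    obtain ⟨m, hm, hP, hQ⟩ := _root_.exists_line hPQ
    refine ⟨m, hm, ?_⟩
    have : ({P, Q} : Finset (ℝ × ℝ)) ⊆ nodesOn {P, Q} m := by
      intro Z hZ
      refine mem_nodesOn.mpr ⟨hZ, ?_⟩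
      rcases Finset.mem_insert.mp hZ with rfl | hZ
      · exact hP
      · rw [Finset.mem_singleton.mp hZ]; exact hQ
    have := Finset.card_le_card this
    omega
  | succ d ih =>
    intro T h hne hc
    have h1 := h.card_ge hne
    have hc' : T.card ≤ 2 * d + 3 := by omega
    have hall : ∀ m : Poly2, T \ nodesOn T m = ∅ → d + 1 + 2 ≤ (nodesOn T m).card := by
      intro m hm
      have := card_offLine T m
      rw [hm, Finset.card_empty] at this
      omega
    obtain ⟨P, hP, Q, hQ, hPQ⟩ := Finset.one_lt_card.mp (show 1 < T.card by omega)
    obtain ⟨m, hm, hmP, hmQ⟩ := _root_.exists_line hPQ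
    have h2 : ({P, Q} : Finset (ℝ × ℝ)) ⊆ nodesOn T m := by
      intro Z hZ
      rcases Finset.mem_insert.mp hZ with rfl | hZ
      · exact mem_nodesOn.mpr ⟨hP, hmP⟩
      · rw [Finset.mem_singleton.mp hZ]; exact mem_nodesOn.mpr ⟨hQ, hmQ⟩
    have h3 := Finset.card_le_card h2
    rw [Finset.card_pair hPQ] at h3
    have h4 := card_offLine T m
    rcases (T \ nodesOn T m).eq_empty_or_nonempty with h0 | h0
    · exact ⟨m, hm, hall m h0⟩
    · obtain ⟨m', hm', hm2⟩ := ih (h.remove hm) h0 (Or.inl (by omega))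
      have h5 : nodesOn (T \ nodesOn T m) m' ⊆ nodesOn T m' := by
        intro Z hZ
        obtain ⟨h6, h7⟩ := mem_nodesOn.mp hZ
        exact mem_nodesOn.mpr ⟨(mem_offLine.mp h6).1, h7⟩
      have h6 := Finset.card_le_card h5
      have h7 := card_offLine T m'
      rcases (T \ nodesOn T m').eq_empty_or_nonempty with h8 | h8
      · exact ⟨m', hm', hall m' h8⟩
      · have := (h.remove hm').card_ge h8
        omega

/-- The nodes off `ℓ` which do not use `ℓ`. -/
noncomputable def restW (n : ℕ) (X : Finset (ℝ × ℝ)) (ℓ : Poly2) : Finset (ℝ × ℝ) :=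
  (X \ nodesOn X ℓ) \ usesSet n X ℓ

lemma mem_restW {n : ℕ} {X : Finset (ℝ × ℝ)} {ℓ : Poly2} {A : ℝ × ℝ} :
    A ∈ restW n X ℓ ↔ A ∈ X ∧ evalPt ℓ A ≠ 0 ∧ A ∉ usesSet n X ℓ := by
  rw [restW, Finset.mem_sdiff, mem_offLine]
  tauto

lemma dep_restW {n : ℕ} {X : Finset (ℝ × ℝ)} {ℓ : Poly2} (hℓ : ℓ.totalDegree = 1) :
    Dep n (restW (n + 1) X ℓ) := by
  intro q hq B hB hz
  obtain ⟨hBX, hBl, hBU⟩ := mem_restW.mp hB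
  by_contra hqB
  have key : ∀ A ∈ usesSet (n + 1) X ℓ, evalPt ℓ A ≠ 0 ∧ ∃ q : Poly2, q.totalDegree ≤ n ∧
      evalPt q A ≠ 0 ∧ ∀ B ∈ X, evalPt ℓ B ≠ 0 → B ≠ A → evalPt q B = 0 :=
    fun A hA => uses_q hℓ (mem_usesSet.mp hA).2
  have key1 := fun A hA => (key A hA).1
  have key2 := fun A hA => (key A hA).2
  choose! g hg1 hg2 hg3 using key2
  set q' : Poly2 := q - ∑ A ∈ usesSet (n + 1) X ℓ, C (evalPt q A / evalPt (g A) A) * g A with hq'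
  have hqe : ∀ Z, evalPt q' Z = evalPt q Z -
      ∑ A ∈ usesSet (n + 1) X ℓ, evalPt q A / evalPt (g A) A * evalPt (g A) Z := by
    intro Z
    rw [hq', evalPt_sub, evalPt_sum]
    simp only [evalPt_mul, evalPt_C]
  have hqd : q'.totalDegree ≤ n := by
    refine (totalDegree_sub _ _).trans (max_le hq ?_)
    refine totalDegree_finsetSum_le (fun A hA => ?_)
    refine (totalDegree_mul _ _).trans ?_
    simpa using hg1 A hA
  have hW : ∀ Z ∈ restW (n + 1) X ℓ, evalPt q' Z = evalPt q Z := by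
    intro Z hZ
    obtain ⟨h1, h2, h3⟩ := mem_restW.mp hZ
    rw [hqe, Finset.sum_eq_zero, sub_zero]
    intro A hA
    rw [hg3 A hA Z h1 h2 (fun e => h3 (e ▸ hA)), mul_zero]
  apply hBU
  refine mem_usesSet.mpr ⟨hBX, uses_of (p := ℓ * q') ?_ ?_ ?_ (Dvd.intro _ rfl)⟩
  · exact (totalDegree_mul _ _).trans (by omega)
  · rw [evalPt_mul, hW B hB]
    exact mul_ne_zero hBl hqB
  · intro Z hZ hZB
    rw [evalPt_mul]
    by_cases hZl : evalPt ℓ Z = 0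
    · rw [hZl, zero_mul]
    · by_cases hZU : Z ∈ usesSet (n + 1) X ℓ
      · rw [hqe, Finset.sum_eq_single Z, div_mul_cancel₀ _ (hg2 Z hZU), sub_self, mul_zero]
        · intro A hA hAZ
          rw [hg3 A hA Z hZ hZl hAZ.symm, mul_zero]
        · intro h0; exact absurd hZU h0
      · have h1 := mem_restW.mpr ⟨hZ, hZl, hZU⟩
        rw [hW Z h1, hz Z h1 hZB, mul_zero]

lemma nodesOn_restW_sub {n : ℕ} {X : Finset (ℝ × ℝ)} {ℓ m : Poly2} :
    nodesOn (restW n X ℓ) m ⊆ nodesOn X m := by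
  intro Z hZ
  obtain ⟨h1, h2⟩ := mem_nodesOn.mp hZ
  exact mem_nodesOn.mpr ⟨(mem_restW.mp h1).1, h2⟩

lemma maximal_of_restW {n : ℕ} {X : Finset (ℝ × ℝ)} (h : GCs (n + 1) X) {ℓ m : Poly2}
    (hm : m.totalDegree = 1) (hc : n + 2 ≤ (nodesOn (restW (n + 1) X ℓ) m).card) :
    IsMaximalLine (n + 1) X m ∧ ∀ A ∈ X, ¬(evalPt m A = 0 ∧ evalPt ℓ A = 0) := by
  have h1 := h.card_line_le hm
  have h2 := Finset.card_le_card (nodesOn_restW_sub (n := n + 1) (X := X) (ℓ := ℓ) (m := m))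
  have h3 := Finset.eq_of_subset_of_card_le
    (nodesOn_restW_sub (n := n + 1) (X := X) (ℓ := ℓ) (m := m)) (by omega)
  refine ⟨⟨hm, by omega⟩, ?_⟩
  rintro A hA ⟨h4, h5⟩
  have h6 : A ∈ nodesOn (restW (n + 1) X ℓ) m := by
    rw [h3]; exact mem_nodesOn.mpr ⟨hA, h4⟩
  exact (mem_restW.mp (mem_nodesOn.mp h6).1).2.1 h5

lemma card_restW {n : ℕ} {X : Finset (ℝ × ℝ)} {ℓ : Poly2} (hℓ : ℓ.totalDegree = 1) :
    (restW (n + 1) X ℓ).card + (usesSet (n + 1) X ℓ).card + (nodesOn X ℓ).card = X.card := by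
  have h1 : usesSet (n + 1) X ℓ ⊆ X \ nodesOn X ℓ := by
    intro A hA
    obtain ⟨h2, h3⟩ := mem_usesSet.mp hA
    exact mem_offLine.mpr ⟨h2, (uses_q hℓ h3).1⟩
  have h2 := Finset.card_sdiff_add_card_eq_card h1
  have h3 := card_offLine X ℓ
  rw [restW]
  omega

lemma part1_exists {n : ℕ} {X : Finset (ℝ × ℝ)} (h : GCs (n + 1) X) {ℓ : Poly2}
    (hℓ : IsKNodeLine X ℓ (n + 1)) (hc : (usesSet (n + 1) X ℓ).card = (n + 1).choose 2) :
    ∃ lam, IsMaximalLine (n + 1) X lam ∧ ∀ A ∈ X, ¬(evalPt lam A = 0 ∧ evalPt ℓ A = 0) := by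
  have h1 := card_restW (n := n) (X := X) hℓ.1
  rw [hc, hℓ.2, h.card] at h1
  have h2 := choose_step n
  have h3 := choose_step (n + 1)
  have h4 : n + 1 + 2 = n + 1 + 1 + 1 := rfl
  rw [h4] at h1
  have hW : (restW (n + 1) X ℓ).card = n + 2 := by omega
  obtain ⟨m, hm, hm2⟩ := (dep_restW (n := n) (X := X) hℓ.1).exists_line
    (Finset.card_pos.mp (by omega)) (Or.inr (by omega))
  exact ⟨m, maximal_of_restW h hm hm2⟩

lemma fin_three : ∀ i a b c : Fin 3, a ≠ i → b ≠ i → c ≠ i → a ≠ b → c = a ∨ c = b := by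
  decide

lemma forced_line {X : Finset (ℝ × ℝ)} (h : GCs 3 X) {ℓ ℓ1 ℓ2 lam lam' : Poly2}
    (hℓ : ℓ.totalDegree = 1) (hℓ1 : ℓ1.totalDegree = 1) (hℓ2 : ℓ2.totalDegree = 1)
    (hlam : lam.totalDegree = 1) (hlam' : IsMaximalLine 3 X lam')
    {A B D u E G : ℝ × ℝ} (hBX : B ∈ X) (hBl : evalPt lam' B ≠ 0)
    (hA : A ∈ X) (hAB : A ≠ B) (hAl : evalPt lam' A ≠ 0)
    (hD : D ∈ X) (hDB : D ≠ B) (hDl : evalPt lam' D ≠ 0)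
    (hu : u ∈ X) (huB : u ≠ B) (hul : evalPt lam' u ≠ 0)
    (hE : E ∈ X) (hEB : E ≠ B) (hEl : evalPt lam' E ≠ 0)
    (hG : G ∈ X) (hGB : G ≠ B) (hGl : evalPt lam' G ≠ 0)
    (hB1 : evalPt ℓ1 B = 0) (hA1 : evalPt ℓ1 A = 0) (hD1 : evalPt ℓ1 D = 0) (hAD : A ≠ D)
    (hBlam : evalPt lam B = 0) (hulam : evalPt lam u = 0) (hElam : evalPt lam E = 0) (huE : u ≠ E)
    (hAℓ : evalPt ℓ A = 0) (huℓ : evalPt ℓ u = 0) (hAu : A ≠ u)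
    (hE2 : evalPt ℓ2 E = 0) (hG2 : evalPt ℓ2 G = 0) (hEG : E ≠ G)
    (hGℓ : evalPt ℓ G ≠ 0) (hD2 : evalPt ℓ2 D ≠ 0) (hA2 : evalPt ℓ2 A ≠ 0) :
    ∃ m : Poly2, m.totalDegree = 1 ∧ evalPt m D = 0 ∧ evalPt m u = 0 ∧ evalPt m G = 0 := by
  obtain ⟨f, hf, hfB, hfc⟩ := h.lines B hBX
  obtain ⟨i, c, hc, hi⟩ := line_mem hf hlam'.1 (T := nodesOn X lam')
    (fun t ht => (mem_nodesOn.mp ht).2)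
    (fun t ht => hfc t (mem_nodesOn.mp ht).1 (fun e => hBl (e ▸ (mem_nodesOn.mp ht).2)))
    (by rw [hlam'.2]; omega)
  have hoff : ∀ P j, evalPt lam' P ≠ 0 → evalPt (f j) P = 0 → j ≠ i := by
    intro P j h1 h2 e
    rw [e, hi, evalPt_mul, evalPt_C] at h2
    exact mul_ne_zero h1 hc h2
  obtain ⟨a, ha⟩ := hfc A hA hAB
  obtain ⟨d, hd⟩ := hfc D hD hDB
  obtain ⟨v, hv⟩ := hfc u hu huB
  obtain ⟨e, he⟩ := hfc E hE hEB
  obtain ⟨g, hg⟩ := hfc G hG hGB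
  have had : a ≠ d := by
    rintro rfl
    exact hfB a (line_zero hℓ1 (hf a) hAD hA1 hD1 ha hd hB1)
  have hve : v ≠ e := by
    rintro rfl
    exact hfB v (line_zero hlam (hf v) huE hulam hElam hv he hBlam)
  have ha' := hoff A a hAl ha
  have hd' := hoff D d hDl hd
  have hv' := hoff u v hul hv
  have he' := hoff E e hEl he
  have hg' := hoff G g hGl hg
  rcases fin_three i a d v ha' hd' hv' had with rfl | rfl
  · exfalso
    rcases fin_three i v d e ha' hd' he' had with rfl | rfl
    · exact hve rfl
    · rcases fin_three i v e g ha' hd' hg' had with rfl | rfl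
      · exact hGℓ (line_zero (hf g) hℓ hAu ha hv hAℓ huℓ hg)
      · exact hD2 (line_zero (hf g) hℓ2 hEG he hg hE2 hG2 hd)
  · rcases fin_three i a v e ha' hd' he' had with rfl | rfl
    · rcases fin_three i e v g ha' hd' hg' had with rfl | rfl
      · exact absurd (line_zero (hf g) hℓ2 hEG he hg hE2 hG2 ha) hA2
      · exact ⟨f g, hf g, hd, hv, hg⟩
    · exact absurd rfl hve

/-- The exceptional configuration, shown to be impossible. -/
structure Conf (n : ℕ) (X : Finset (ℝ × ℝ)) (ℓ ℓ1 ℓ2 : Poly2) : Prop where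
  hl : IsKNodeLine X ℓ n
  hl2 : IsKNodeLine X ℓ2 n
  d1 : ℓ1.totalDegree = 1
  off : ∀ A ∈ X, evalPt ℓ2 A = 0 → evalPt ℓ A ≠ 0
  off1 : ∀ A ∈ X, evalPt ℓ2 A = 0 → evalPt ℓ1 A ≠ 0
  c1 : (nodesOn (X \ nodesOn X ℓ) ℓ1).card = n
  ind : ∀ z ∈ ((X \ nodesOn X ℓ) \ nodesOn X ℓ1) \ nodesOn X ℓ2, ∃ r : Poly2,
    r.totalDegree + 3 ≤ n ∧ evalPt r z ≠ 0 ∧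
    ∀ z' ∈ ((X \ nodesOn X ℓ) \ nodesOn X ℓ1) \ nodesOn X ℓ2, z' ≠ z → evalPt r z' = 0

lemma Conf.count {k : ℕ} {X : Finset (ℝ × ℝ)} {ℓ ℓ1 ℓ2 lam : Poly2}
    (c : Conf (k + 3) X ℓ ℓ1 ℓ2) (hlam : IsMaximalLine (k + 3) X lam)
    (hne : ∃ Q, evalPt ℓ1 Q = 0 ∧ evalPt lam Q ≠ 0) :
    (∃ u ∈ X, evalPt lam u = 0 ∧ evalPt ℓ u = 0) ∧ (∃ u ∈ X, evalPt lam u = 0 ∧ evalPt ℓ2 u = 0) ∧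
    (∃ u ∈ X, evalPt lam u = 0 ∧ evalPt ℓ1 u = 0 ∧ evalPt ℓ u ≠ 0) ∧
    (nodesOn (((X \ nodesOn X ℓ) \ nodesOn X ℓ1) \ nodesOn X ℓ2) lam).card = k + 1 := by
  set Z := ((X \ nodesOn X ℓ) \ nodesOn X ℓ1) \ nodesOn X ℓ2 with hZ
  have hlℓ := knode_ne hlam c.hl (by omega)
  have hlℓ2 := knode_ne hlam c.hl2 (by omega)
  have hlℓ1 := off_symm c.d1 hlam.1 hne
  have one : ∀ (σ : Poly2), σ.totalDegree = 1 → (∃ Q, evalPt lam Q = 0 ∧ evalPt σ Q ≠ 0) →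
      ∀ S : Finset (ℝ × ℝ), (nodesOn (nodesOn S lam) σ).card ≤ 1 := by
    intro σ hσ ⟨Q, hQ1, hQ2⟩ S
    refine card_inter_le_one hlam.1 hσ hQ1 hQ2 _ (fun A hA => ?_)
    obtain ⟨h1, h2⟩ := mem_nodesOn.mp hA
    exact ⟨(mem_nodesOn.mp h1).2, h2⟩
  have a1 := one ℓ c.hl.1 hlℓ X
  have a2 := one ℓ2 c.hl2.1 hlℓ2 X
  have a3 := one ℓ1 c.d1 hlℓ1 (X \ nodesOn X ℓ)
  have a4 : (nodesOn Z lam).card ≤ k + 1 := by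
    by_contra hlt
    obtain ⟨z, hz⟩ : (nodesOn Z lam).Nonempty := Finset.card_pos.mp (by omega)
    obtain ⟨hzZ, hzl⟩ := mem_nodesOn.mp hz
    obtain ⟨r, hr1, hr2, hr3⟩ := c.ind z hzZ
    obtain ⟨s, hs, -⟩ := line_dvd (f := lam) (p := r) hlam.1 ((nodesOn Z lam).erase z)
      (fun B hB => (mem_nodesOn.mp (Finset.mem_of_mem_erase hB)).2)
      (fun B hB => hr3 B (mem_nodesOn.mp (Finset.mem_of_mem_erase hB)).1 (Finset.ne_of_mem_erase hB))
      (by rw [Finset.card_erase_of_mem hz]; omega)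
    rw [hs, evalPt_mul, hzl, zero_mul] at hr2
    exact hr2 rfl
  have hsub : nodesOn X lam ⊆ nodesOn (nodesOn X lam) ℓ ∪ (nodesOn (nodesOn X lam) ℓ2 ∪
      (nodesOn (nodesOn (X \ nodesOn X ℓ) lam) ℓ1 ∪ nodesOn Z lam)) := by
    intro A hA
    simp only [Finset.mem_union, hZ, mem_nodesOn, Finset.mem_sdiff] at hA ⊢
    tauto
  have t0 := Finset.card_le_card hsub
  have t1 := Finset.card_union_le (nodesOn (nodesOn X lam) ℓ) (nodesOn (nodesOn X lam) ℓ2 ∪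
      (nodesOn (nodesOn (X \ nodesOn X ℓ) lam) ℓ1 ∪ nodesOn Z lam))
  have t2 := Finset.card_union_le (nodesOn (nodesOn X lam) ℓ2)
      (nodesOn (nodesOn (X \ nodesOn X ℓ) lam) ℓ1 ∪ nodesOn Z lam)
  have t3 := Finset.card_union_le (nodesOn (nodesOn (X \ nodesOn X ℓ) lam) ℓ1) (nodesOn Z lam)
  rw [hlam.2] at t0
  refine ⟨?_, ?_, ?_, by omega⟩
  · obtain ⟨u, hu⟩ := Finset.card_pos.mp (show 0 < (nodesOn (nodesOn X lam) ℓ).card by omega)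
    obtain ⟨h1, h2⟩ := mem_nodesOn.mp hu
    obtain ⟨h3, h4⟩ := mem_nodesOn.mp h1
    exact ⟨u, h3, h4, h2⟩
  · obtain ⟨u, hu⟩ := Finset.card_pos.mp (show 0 < (nodesOn (nodesOn X lam) ℓ2).card by omega)
    obtain ⟨h1, h2⟩ := mem_nodesOn.mp hu
    obtain ⟨h3, h4⟩ := mem_nodesOn.mp h1
    exact ⟨u, h3, h4, h2⟩
  · obtain ⟨u, hu⟩ := Finset.card_pos.mp
      (show 0 < (nodesOn (nodesOn (X \ nodesOn X ℓ) lam) ℓ1).card by omega)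
    obtain ⟨h1, h2⟩ := mem_nodesOn.mp hu
    obtain ⟨h3, h4⟩ := mem_nodesOn.mp h1
    obtain ⟨h5, h6⟩ := mem_offLine.mp h3
    exact ⟨u, h5, h4, h2, h6⟩

lemma Conf.step {k : ℕ} {X : Finset (ℝ × ℝ)} {ℓ ℓ1 ℓ2 lam : Poly2}
    (c : Conf (k + 1 + 3) X ℓ ℓ1 ℓ2) (hlam : IsMaximalLine (k + 1 + 3) X lam)
    (hne : ∃ Q, evalPt ℓ1 Q = 0 ∧ evalPt lam Q ≠ 0) :
    Conf (k + 3) (X \ nodesOn X lam) ℓ ℓ1 ℓ2 := by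
  obtain ⟨⟨u, hu, hul, huℓ⟩, ⟨E, hE, hEl, hEℓ⟩, ⟨B, hB, hBl, hB1, hBℓ⟩, hZc⟩ := c.count hlam hne
  have hmem : ∀ z, z ∈ (((X \ nodesOn X lam) \ nodesOn (X \ nodesOn X lam) ℓ) \
      nodesOn (X \ nodesOn X lam) ℓ1) \ nodesOn (X \ nodesOn X lam) ℓ2 ↔
      z ∈ ((X \ nodesOn X ℓ) \ nodesOn X ℓ1) \ nodesOn X ℓ2 ∧ evalPt lam z ≠ 0 := by
    intro z
    rw [mem_rest, mem_rest, mem_offLine]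
    tauto
  refine ⟨maximal_remove hlam.1 c.hl (knode_ne hlam c.hl (by omega)) hu hul huℓ,
    maximal_remove hlam.1 c.hl2 (knode_ne hlam c.hl2 (by omega)) hE hEl hEℓ, c.d1,
    fun A hA => c.off A (mem_offLine.mp hA).1, fun A hA => c.off1 A (mem_offLine.mp hA).1, ?_, ?_⟩
  · have h1 := maximal_remove (X := X \ nodesOn X ℓ) (τ := ℓ1) (k := k + 3) hlam.1 ⟨c.d1, c.c1⟩
      (off_symm c.d1 hlam.1 hne) (mem_offLine.mpr ⟨hB, hBℓ⟩) hBl hB1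
    rw [← h1.2]
    congr 1
    ext A
    simp only [mem_nodesOn, mem_offLine]
    tauto
  · intro z hz
    obtain ⟨hz1, hz2⟩ := (hmem z).mp hz
    obtain ⟨r, hr1, hr2, hr3⟩ := c.ind z hz1
    obtain ⟨s, hs, hsd⟩ := line_dvd (f := lam) (p := r) hlam.1
      (nodesOn (((X \ nodesOn X ℓ) \ nodesOn X ℓ1) \ nodesOn X ℓ2) lam)
      (fun B hB => (mem_nodesOn.mp hB).2)
      (fun B hB => hr3 B (mem_nodesOn.mp hB).1 (fun e => hz2 (e ▸ (mem_nodesOn.mp hB).2)))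
      (by rw [hZc]; omega)
    have hsz : evalPt s z ≠ 0 := fun h0 => hr2 (by rw [hs, evalPt_mul, h0, mul_zero])
    refine ⟨s, ?_, hsz, ?_⟩
    · rcases hsd with h0 | h0
      · exact absurd (by rw [h0, evalPt_zero]) hsz
      · omega
    · intro z' hz' hne'
      obtain ⟨h1, h2⟩ := (hmem z').mp hz'
      have h3 := hr3 z' h1 hne'
      rw [hs, evalPt_mul] at h3
      exact (mul_eq_zero.mp h3).resolve_left h2

lemma exists_other {S : Finset (ℝ × ℝ)} (a b : ℝ × ℝ) (h : 3 ≤ S.card) :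
    ∃ g ∈ S, g ≠ a ∧ g ≠ b := by
  by_contra hcon
  push Not at hcon
  have : S ⊆ {a, b} := by
    intro x hx
    by_cases hxa : x = a
    · simp [hxa]
    · simp [hcon x hx hxa]
  have h1 := Finset.card_le_card this
  have h2 := Finset.card_le_two (a := a) (b := b)
  omega

lemma Conf.base {X : Finset (ℝ × ℝ)} (h : GCs 3 X) {ℓ ℓ1 ℓ2 : Poly2} (c : Conf 3 X ℓ ℓ1 ℓ2)
    (hP : ∀ A ∈ X, ∃ lam, IsMaximalLine 3 X lam ∧ evalPt lam A ≠ 0) : False := by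
  set Z := ((X \ nodesOn X ℓ) \ nodesOn X ℓ1) \ nodesOn X ℓ2 with hZ
  have hZc : Z.card = 1 := by
    have h1 := card_offLine X ℓ
    have h2 := card_offLine (X \ nodesOn X ℓ) ℓ1
    have h3 : nodesOn X ℓ2 ⊆ (X \ nodesOn X ℓ) \ nodesOn X ℓ1 := by
      intro A hA
      obtain ⟨hA1, hA2⟩ := mem_nodesOn.mp hA
      exact Finset.mem_sdiff.mpr ⟨mem_offLine.mpr ⟨hA1, c.off A hA1 hA2⟩,
        fun h0 => c.off1 A hA1 hA2 (mem_nodesOn.mp h0).2⟩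
    have h4 := Finset.card_sdiff_add_card_eq_card h3
    rw [← sdiff_nodesOn, c.c1] at h2
    rw [c.hl2.2, ← hZ] at h4
    rw [c.hl.2, h.card] at h1
    have : (3 + 2).choose 2 = 10 := rfl
    omega
  obtain ⟨z, hz⟩ := Finset.card_eq_one.mp hZc
  have hzZ : z ∈ Z := by rw [hz]; simp
  obtain ⟨hzX, hzℓ, hz1, hz2⟩ := mem_rest.mp hzZ
  have key : ∀ lam, IsMaximalLine 3 X lam → (∃ Q, evalPt ℓ1 Q = 0 ∧ evalPt lam Q ≠ 0) →
      evalPt lam z = 0 := by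
    intro lam hlam hne
    have h1 := (Conf.count (k := 0) c hlam hne).2.2.2
    obtain ⟨w, hw⟩ := Finset.card_pos.mp (by rw [h1]; omega)
    obtain ⟨hw1, hw2⟩ := mem_nodesOn.mp hw
    have : w ∈ Z := hw1
    rw [hz, Finset.mem_singleton] at this
    exact this ▸ hw2
  -- the line ℓ1 is maximal
  obtain ⟨A, hAX, hAℓ, hA1⟩ : ∃ A ∈ X, evalPt ℓ A = 0 ∧ evalPt ℓ1 A = 0 := by
    obtain ⟨lam, hlam, hlz⟩ := hP z hzX
    have hsame : ∀ Q, evalPt ℓ1 Q = 0 → evalPt lam Q = 0 := by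
      by_contra h0
      push Not at h0
      exact hlz (key lam hlam h0)
    by_contra hcon
    push Not at hcon
    have h1 : nodesOn X lam ⊆ nodesOn (X \ nodesOn X ℓ) ℓ1 := by
      intro B hB
      obtain ⟨hBX, hBl⟩ := mem_nodesOn.mp hB
      have hB1 : evalPt ℓ1 B = 0 := by
        by_contra h0
        obtain ⟨Q, hQ1, hQ2⟩ := off_symm hlam.1 c.d1 ⟨B, hBl, h0⟩
        exact hQ2 (hsame Q hQ1)
      exact mem_nodesOn.mpr ⟨mem_offLine.mpr ⟨hBX, fun h0 => hcon B hBX h0 hB1⟩, hB1⟩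
    have h2 := Finset.card_le_card h1
    rw [hlam.2, c.c1] at h2
    omega
  obtain ⟨lam, hlam, hlA⟩ := hP A hAX
  obtain ⟨⟨u, hu, hul, huℓ⟩, ⟨E, hE, hEl, hE2⟩, ⟨B, hB, hBl, hB1, hBℓ⟩, -⟩ :=
    Conf.count (k := 0) c hlam ⟨A, hA1, hlA⟩
  have hlz := key lam hlam ⟨A, hA1, hlA⟩
  obtain ⟨lam', hlam', hlB'⟩ := hP B hB
  obtain ⟨⟨v, hv, hvl, hvℓ⟩, ⟨F, hF, hFl, hF2⟩, ⟨K, hK, hKl, hK1, hKℓ⟩, -⟩ :=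
    Conf.count (k := 0) c hlam' ⟨B, hB1, hlB'⟩
  have hlz' := key lam' hlam' ⟨B, hB1, hlB'⟩
  have n1 : ∃ Q, evalPt lam Q = 0 ∧ evalPt lam' Q ≠ 0 := ⟨B, hBl, hlB'⟩
  have nl1 : ∃ Q, evalPt ℓ1 Q = 0 ∧ evalPt lam Q ≠ 0 := ⟨A, hA1, hlA⟩
  have nl1' : ∃ Q, evalPt ℓ1 Q = 0 ∧ evalPt lam' Q ≠ 0 := ⟨B, hB1, hlB'⟩
  have nl : ∃ Q, evalPt ℓ Q = 0 ∧ evalPt lam Q ≠ 0 := ⟨A, hAℓ, hlA⟩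
  have nl' : ∃ Q, evalPt ℓ Q = 0 ∧ evalPt lam' Q ≠ 0 :=
    off_symm hlam'.1 c.hl.1 (knode_ne hlam' c.hl (by omega))
  have nl2 : ∃ Q, evalPt ℓ2 Q = 0 ∧ evalPt lam Q ≠ 0 :=
    off_symm hlam.1 c.hl2.1 (knode_ne hlam c.hl2 (by omega))
  have nl2' : ∃ Q, evalPt ℓ2 Q = 0 ∧ evalPt lam' Q ≠ 0 :=
    off_symm hlam'.1 c.hl2.1 (knode_ne hlam' c.hl2 (by omega))
  have huz : u ≠ z := fun e => hzℓ (e ▸ huℓ)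
  have hvz : v ≠ z := fun e => hzℓ (e ▸ hvℓ)
  have hEz : E ≠ z := fun e => hz2 (e ▸ hE2)
  have hFz : F ≠ z := fun e => hz2 (e ▸ hF2)
  have hKz : K ≠ z := fun e => hz1 (e ▸ hK1)
  have lamz : ∀ W, W ≠ z → evalPt lam W = 0 → evalPt lam' W ≠ 0 :=
    fun W hW h1 h2 => hW (meet_unique hlam.1 hlam'.1 n1 h1 h2 hlz hlz')
  have hAK : A ≠ K := fun e => hKℓ (e ▸ hAℓ)
  have hAB : A ≠ B := fun e => hBℓ (e ▸ hAℓ)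
  have hlA' : evalPt lam' A ≠ 0 := fun h0 => hAK (meet_unique c.d1 hlam'.1 nl1' hA1 h0 hK1 hKl)
  have hKlam : evalPt lam K ≠ 0 := fun h0 => lamz K hKz h0 hKl
  have hBK : B ≠ K := fun e => hKlam (e ▸ hBl)
  -- remaining nodes
  obtain ⟨G, hG, hGE, hGF⟩ := exists_other E F (S := nodesOn X ℓ2) (by rw [c.hl2.2])
  obtain ⟨hGX, hG2⟩ := mem_nodesOn.mp hG
  obtain ⟨D, hD, hDB, hDK⟩ := exists_other B K (S := nodesOn (X \ nodesOn X ℓ) ℓ1) (by rw [c.c1])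
  obtain ⟨hD0, hD1⟩ := mem_nodesOn.mp hD
  obtain ⟨hDX, hDℓ⟩ := mem_offLine.mp hD0
  have hAD : A ≠ D := fun e => hDℓ (e ▸ hAℓ)
  have off2 : ∀ W ∈ X, evalPt ℓ1 W = 0 → evalPt ℓ2 W ≠ 0 := fun W hW h1 h2 => c.off1 W hW h2 h1
  have hGl : evalPt lam G ≠ 0 := fun h0 => hGE (meet_unique c.hl2.1 hlam.1 nl2 hG2 h0 hE2 hEl)
  have hGl' : evalPt lam' G ≠ 0 := fun h0 => hGF (meet_unique c.hl2.1 hlam'.1 nl2' hG2 h0 hF2 hFl)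
  have hDl : evalPt lam D ≠ 0 := fun h0 => hDB (meet_unique c.d1 hlam.1 nl1 hD1 h0 hB1 hBl)
  have hDl' : evalPt lam' D ≠ 0 := fun h0 => hDK (meet_unique c.d1 hlam'.1 nl1' hD1 h0 hK1 hKl)
  have hGℓ := c.off G hGX hG2
  have hvlam : evalPt lam v ≠ 0 := fun h0 => lamz v hvz h0 hvl
  have hFlam : evalPt lam F ≠ 0 := fun h0 => lamz F hFz h0 hFl
  obtain ⟨m, hm, hmD, hmu, hmG⟩ := forced_line h c.hl.1 c.d1 c.hl2.1 hlam.1 hlam' hB hlB'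
    hAX hAB hlA' hDX hDB hDl' hu (fun e => hBℓ (e ▸ huℓ)) (lamz u huz hul)
    hE (fun e => off2 B hB hB1 (e ▸ hE2)) (lamz E hEz hEl)
    hGX (fun e => off2 B hB hB1 (e ▸ hG2)) hGl' hB1 hA1 hD1 hAD hBl hul hEl
    (fun e => c.off E hE hE2 (e ▸ huℓ)) hAℓ huℓ (fun e => hlA (e ▸ hul)) hE2 hG2 hGE.symm hGℓ
    (off2 D hDX hD1) (off2 A hAX hA1)
  obtain ⟨m', hm', hmD', hmv', hmG'⟩ := forced_line h c.hl.1 c.d1 c.hl2.1 hlam'.1 hlam hK hKlam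
    hAX hAK hlA hDX hDK hDl hv (fun e => hKℓ (e ▸ hvℓ)) hvlam
    hF (fun e => off2 K hK hK1 (e ▸ hF2)) hFlam
    hGX (fun e => off2 K hK hK1 (e ▸ hG2)) hGl hK1 hA1 hD1 hAD hKl hvl hFl
    (fun e => c.off F hF hF2 (e ▸ hvℓ)) hAℓ hvℓ (fun e => hlA' (e ▸ hvl)) hF2 hG2 hGF.symm hGℓ
    (off2 D hDX hD1) (off2 A hAX hA1)
  have hDG : D ≠ G := fun e => off2 D hDX hD1 (e ▸ hG2)
  have hmv : evalPt m v = 0 := line_zero hm' hm hDG hmD' hmG' hmD hmG hmv'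
  have huv : u ≠ v := fun e => hvlam (e ▸ hul)
  exact hGℓ (line_zero hm c.hl.1 huv hmu hmv huℓ hvℓ hmG)

lemma Conf.false {k : ℕ} : (∀ m ≤ k + 3, GM m) → ∀ {X : Finset (ℝ × ℝ)}, GCs (k + 3) X →
    ∀ {ℓ ℓ1 ℓ2 : Poly2}, Conf (k + 3) X ℓ ℓ1 ℓ2 → False := by
  induction k with
  | zero =>
    intro hGM X h ℓ ℓ1 ℓ2 c
    exact Conf.base h c (exists_maximal_avoid 2 hGM X h)
  | succ k ih =>
    intro hGM X h ℓ ℓ1 ℓ2 c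
    obtain ⟨B, hB⟩ := Finset.card_pos.mp (show 0 < (nodesOn (X \ nodesOn X ℓ) ℓ1).card by
      rw [c.c1]; omega)
    obtain ⟨hB0, hB1⟩ := mem_nodesOn.mp hB
    obtain ⟨lam, hlam, hlB⟩ := exists_maximal_avoid (k + 3) hGM X h B (mem_offLine.mp hB0).1
    exact ih (fun m hm => hGM m (by omega)) (GCs.remove (n := k + 3) h hlam)
      (c.step hlam ⟨B, hB1, hlB⟩)

lemma uses_split {k : ℕ} {X : Finset (ℝ × ℝ)} {ℓ ℓ1 ℓ2 : Poly2} (hℓ : ℓ.totalDegree = 1)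
    (d1 : ℓ1.totalDegree = 1) (d2 : ℓ2.totalDegree = 1)
    (hW' : ∀ w ∈ restW (k + 3) X ℓ, evalPt ℓ1 w = 0 → evalPt ℓ2 w ≠ 0)
    (c1 : (nodesOn (restW (k + 3) X ℓ) ℓ1).card = k + 3)
    (c2 : (nodesOn (restW (k + 3) X ℓ) ℓ2).card = k + 3) {z : ℝ × ℝ}
    (hz : z ∈ usesSet (k + 3) X ℓ) : evalPt ℓ z ≠ 0 ∧ evalPt ℓ1 z ≠ 0 ∧ evalPt ℓ2 z ≠ 0 ∧
      ∃ s : Poly2, s.totalDegree ≤ k ∧ evalPt s z ≠ 0 ∧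
        ∀ B ∈ X, evalPt ℓ B ≠ 0 → evalPt ℓ1 B ≠ 0 → evalPt ℓ2 B ≠ 0 → B ≠ z → evalPt s B = 0 := by
  obtain ⟨hzl, q, hq, hqz, hqB⟩ := uses_q (n := k + 2) hℓ (mem_usesSet.mp hz).2
  have hqW : ∀ w ∈ restW (k + 3) X ℓ, evalPt q w = 0 := by
    intro w hw
    obtain ⟨h1, h2, h3⟩ := mem_restW.mp hw
    exact hqB w h1 h2 (fun e => h3 (e ▸ hz))
  obtain ⟨r, hr, hrd⟩ := line_dvd (f := ℓ2) (p := q) d2 (nodesOn (restW (k + 3) X ℓ) ℓ2)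
    (fun B hB => (mem_nodesOn.mp hB).2) (fun B hB => hqW B (mem_nodesOn.mp hB).1)
    (by rw [c2]; omega)
  rw [hr, evalPt_mul] at hqz
  have hrz := right_ne_zero_of_mul hqz
  have hrd' : r.totalDegree + 1 ≤ k + 2 := by
    rcases hrd with h0 | h0
    · exact absurd (by rw [h0, evalPt_zero]) hrz
    · omega
  obtain ⟨s, hs, hsd⟩ := line_dvd (f := ℓ1) (p := r) d1 (nodesOn (restW (k + 3) X ℓ) ℓ1)
    (fun B hB => (mem_nodesOn.mp hB).2) (fun B hB => by
      obtain ⟨h1, h2⟩ := mem_nodesOn.mp hB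
      have h3 := hqW B h1
      rw [hr, evalPt_mul] at h3
      exact (mul_eq_zero.mp h3).resolve_left (hW' B h1 h2))
    (by rw [c1]; omega)
  rw [hs, evalPt_mul] at hrz
  have hsz := right_ne_zero_of_mul hrz
  have hsd' : s.totalDegree ≤ k := by
    rcases hsd with h0 | h0
    · exact absurd (by rw [h0, evalPt_zero]) hsz
    · omega
  refine ⟨hzl, left_ne_zero_of_mul hrz, left_ne_zero_of_mul hqz, s, hsd', hsz, ?_⟩
  intro B hB h0 h1 h2 h3
  have h4 := hqB B hB h0 h3
  rw [hr, hs, evalPt_mul, evalPt_mul] at h4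
  exact (mul_eq_zero.mp ((mul_eq_zero.mp h4).resolve_left h2)).resolve_left h1

lemma conf_of {k : ℕ} {X : Finset (ℝ × ℝ)} {ℓ ℓ1 ℓ2 : Poly2} (hℓ : IsKNodeLine X ℓ (k + 3))
    (d1 : ℓ1.totalDegree = 1) (d2 : ℓ2.totalDegree = 1)
    (hW : ∀ w ∈ restW (k + 3) X ℓ, evalPt ℓ1 w = 0 ∨ evalPt ℓ2 w = 0)
    (hW' : ∀ w ∈ restW (k + 3) X ℓ, evalPt ℓ1 w = 0 → evalPt ℓ2 w ≠ 0)
    (c1 : (nodesOn (restW (k + 3) X ℓ) ℓ1).card = k + 3)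
    (c2 : (nodesOn (restW (k + 3) X ℓ) ℓ2).card = k + 3)
    (miss : ∀ A ∈ X, evalPt ℓ2 A = 0 → evalPt ℓ A ≠ 0) : Conf (k + 3) X ℓ ℓ1 ℓ2 := by
  have hU := fun {z} (hz : z ∈ usesSet (k + 3) X ℓ) => uses_split hℓ.1 d1 d2 hW' c1 c2 hz
  refine ⟨hℓ, ⟨d2, ?_⟩, d1, miss, ?_, ?_, ?_⟩
  · rw [← c2]
    congr 1
    ext A
    simp only [mem_nodesOn, mem_restW]
    constructor
    · rintro ⟨h1, h2⟩
      exact ⟨⟨h1, miss A h1 h2, fun h3 => (hU h3).2.2.1 h2⟩, h2⟩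
    · rintro ⟨⟨h1, -⟩, h2⟩
      exact ⟨h1, h2⟩
  · intro A hA h2 h1
    exact hW' A (mem_restW.mpr ⟨hA, miss A hA h2, fun h3 => (hU h3).2.2.1 h2⟩) h1 h2
  · rw [← c1]
    congr 1
    ext A
    simp only [mem_nodesOn, mem_restW, mem_offLine]
    constructor
    · rintro ⟨⟨h1, h2⟩, h3⟩
      exact ⟨⟨h1, h2, fun h4 => (hU h4).2.1 h3⟩, h3⟩
    · rintro ⟨⟨h1, h2, -⟩, h3⟩
      exact ⟨⟨h1, h2⟩, h3⟩
  · intro z hz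
    obtain ⟨hzX, h0, h1, h2⟩ := mem_rest.mp hz
    have hzU : z ∈ usesSet (k + 3) X ℓ := by
      by_contra hcon
      rcases hW z (mem_restW.mpr ⟨hzX, h0, hcon⟩) with h3 | h3
      · exact h1 h3
      · exact h2 h3
    obtain ⟨-, -, -, s, hs, hsz, hsB⟩ := hU hzU
    refine ⟨s, by omega, hsz, ?_⟩
    intro z' hz' hne
    obtain ⟨h3, h4, h5, h6⟩ := mem_rest.mp hz'
    exact hsB z' h3 h4 h5 h6 hne

/-- One of the lines of the fundamental polynomial of a user of `ℓ` is `ℓ`. -/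
lemma lines_contain {n : ℕ} {X : Finset (ℝ × ℝ)} (h : GCs n X) {ℓ : Poly2}
    (hℓ : ℓ.totalDegree = 1) {A : ℝ × ℝ} (hA : A ∈ X) (hU : Uses n X ℓ A) :
    ∃ f : Fin n → Poly2, (∀ i, (f i).totalDegree = 1) ∧
      (∀ B ∈ X, B ≠ A → ∃ i, evalPt (f i) B = 0) ∧ ∃ i, ∃ c : ℝ, c ≠ 0 ∧ f i = ℓ * C c := by
  obtain ⟨f, hf, hfA, hfB⟩ := h.lines A hA
  obtain ⟨p, ⟨hp1, hp2, hp3⟩, q, rfl⟩ := hU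
  have h0 := h.poised (∏ i, f i - C (evalPt (∏ i, f i) A) * (ℓ * q)) (by
    refine (totalDegree_sub _ _).trans (max_le ?_ ?_)
    · simpa using totalDegree_prod_lines Finset.univ f (fun j _ => hf j)
    · refine (totalDegree_mul _ _).trans ?_
      simpa using hp1) (by
    intro B hB
    rw [evalPt_sub, evalPt_mul, evalPt_C]
    by_cases hBA : B = A
    · rw [hBA, hp2, mul_one, sub_self]
    · obtain ⟨i, hi⟩ := hfB B hB hBA
      rw [hp3 B hB hBA, mul_zero, sub_zero, evalPt_prod, Finset.prod_eq_zero (Finset.mem_univ i) hi])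
  obtain ⟨T, hT, hTz⟩ := exists_points hℓ ∅ (n + 1)
  refine ⟨f, hf, hfB, line_mem hf hℓ (T := T) (fun t ht => (hTz t ht).1) (fun t ht => ?_)
    (by omega)⟩
  have h1 := congrArg (fun r => evalPt r t) h0
  simp only [evalPt_sub, evalPt_mul, (hTz t ht).1, evalPt_zero, zero_mul, mul_zero, sub_zero,
    evalPt_prod] at h1
  obtain ⟨i, -, hi⟩ := Finset.prod_eq_zero_iff.mp h1
  exact ⟨i, hi⟩

lemma part2_big {k : ℕ} (hGM : ∀ m ≤ k + 3, GM m) {X : Finset (ℝ × ℝ)} (h : GCs (k + 3) X)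
    {ℓ : Poly2} (hℓ : IsKNodeLine X ℓ (k + 3))
    (hc : (usesSet (k + 3) X ℓ).card = (k + 2).choose 2) :
    ∃ σ τ : Poly2, IsMaximalLine (k + 3) X σ ∧ IsMaximalLine (k + 3) X τ ∧
      (∃ Q, evalPt σ Q = 0 ∧ evalPt τ Q ≠ 0) ∧
      ∃ a ∈ X, evalPt σ a = 0 ∧ evalPt τ a = 0 ∧ evalPt ℓ a = 0 := by
  have e1 := choose_step (k + 1)
  have e2 := choose_step (k + 2)
  have e3 := choose_step (k + 3)
  have r1 : k + 1 + 1 = k + 2 := rfl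
  have r2 : k + 2 + 1 = k + 3 := rfl
  have r3 : k + 3 + 1 = k + 4 := rfl
  have r4 : k + 4 + 1 = k + 5 := rfl
  rw [r1, r2] at e1
  rw [r2, r3] at e2
  rw [r3, r4] at e3
  have hWc : (restW (k + 3) X ℓ).card = 2 * k + 6 := by
    have h1 := card_restW (n := k + 2) (X := X) hℓ.1
    have h2 := h.card
    have r5 : k + 3 + 2 = k + 5 := rfl
    rw [r2, hc, hℓ.2] at h1
    rw [r5] at h2
    omega
  have hdep : Dep (k + 1 + 1) (restW (k + 3) X ℓ) := dep_restW (n := k + 2) hℓ.1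
  have hle : ∀ m : Poly2, m.totalDegree = 1 → (nodesOn (restW (k + 3) X ℓ) m).card ≤ k + 3 := by
    intro m hm
    by_contra hlt
    obtain ⟨h1, h2⟩ := maximal_of_restW (n := k + 2) h (ℓ := ℓ) hm (by
      rw [r2]; omega)
    have h3 := part1_card (n := k + 2) h hℓ h1 h2
    rw [r2, hc] at h3
    omega
  -- a line with three points of W
  obtain ⟨A, hA⟩ : (usesSet (k + 3) X ℓ).Nonempty := Finset.card_pos.mp (by
    rw [hc]; exact Nat.choose_pos (by omega))
  obtain ⟨hAX, hAU⟩ := mem_usesSet.mp hA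
  obtain ⟨f, hf, hfB, i, c, hc0, hi⟩ := lines_contain h hℓ.1 hAX hAU
  have hcov : ∀ w ∈ restW (k + 3) X ℓ, ∃ j ∈ Finset.univ.erase i, evalPt (f j) w = 0 := by
    intro w hw
    obtain ⟨h1, h2, h3⟩ := mem_restW.mp hw
    obtain ⟨j, hj⟩ := hfB w h1 (fun e => h3 (e ▸ hA))
    refine ⟨j, Finset.mem_erase.mpr ⟨?_, Finset.mem_univ _⟩, hj⟩
    rintro rfl
    rw [hi, evalPt_mul, evalPt_C] at hj
    exact mul_ne_zero h2 hc0 hj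
  choose! φ hφ1 hφ2 using hcov
  obtain ⟨j, hj, hj2⟩ := Finset.exists_lt_card_fiber_of_mul_lt_card_of_maps_to (n := 2)
    (s := restW (k + 3) X ℓ) (t := Finset.univ.erase i) (f := φ) hφ1 (by
      rw [Finset.card_erase_of_mem (Finset.mem_univ i), Finset.card_univ, Fintype.card_fin, hWc]
      omega)
  have h3W : 3 ≤ (nodesOn (restW (k + 3) X ℓ) (f j)).card := by
    refine le_trans hj2 (Finset.card_le_card ?_)
    intro w hw
    obtain ⟨h1, h2⟩ := Finset.mem_filter.mp hw
    exact mem_nodesOn.mpr ⟨h1, h2 ▸ hφ2 w h1⟩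
  have h4W := hle (f j) (hf j)
  have h5W := card_offLine (restW (k + 3) X ℓ) (f j)
  obtain ⟨ℓ2, d2, hc2⟩ := (hdep.remove (hf j)).exists_line
    (Finset.card_pos.mp (by omega)) (Or.inl (by omega))
  have c2 : (nodesOn (restW (k + 3) X ℓ) ℓ2).card = k + 3 := by
    have h1 := hle ℓ2 d2
    have h2 : nodesOn (restW (k + 3) X ℓ \ nodesOn (restW (k + 3) X ℓ) (f j)) ℓ2 ⊆
        nodesOn (restW (k + 3) X ℓ) ℓ2 := by
      intro w hw
      obtain ⟨h3, h4⟩ := mem_nodesOn.mp hw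
      exact mem_nodesOn.mpr ⟨(mem_offLine.mp h3).1, h4⟩
    have h3 := Finset.card_le_card h2
    omega
  have h6W := card_offLine (restW (k + 3) X ℓ) ℓ2
  obtain ⟨ℓ1, d1, hc1⟩ := (hdep.remove d2).exists_line
    (Finset.card_pos.mp (by omega)) (Or.inr (by omega))
  have hs1 : nodesOn (restW (k + 3) X ℓ \ nodesOn (restW (k + 3) X ℓ) ℓ2) ℓ1 =
      restW (k + 3) X ℓ \ nodesOn (restW (k + 3) X ℓ) ℓ2 :=
    Finset.eq_of_subset_of_card_le (fun w hw => (mem_nodesOn.mp hw).1) (by omega)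
  have hsub1 : nodesOn (restW (k + 3) X ℓ \ nodesOn (restW (k + 3) X ℓ) ℓ2) ℓ1 ⊆
        nodesOn (restW (k + 3) X ℓ) ℓ1 := by
    intro w hw
    obtain ⟨h3, h4⟩ := mem_nodesOn.mp hw
    exact mem_nodesOn.mpr ⟨(mem_offLine.mp h3).1, h4⟩
  have hle1 := hle ℓ1 d1
  have hs2 := Finset.eq_of_subset_of_card_le hsub1 (by omega)
  have c1 : (nodesOn (restW (k + 3) X ℓ) ℓ1).card = k + 3 := by
    rw [← hs2]
    rw [← hs2] at hle1
    omega
  have hW : ∀ w ∈ restW (k + 3) X ℓ, evalPt ℓ1 w = 0 ∨ evalPt ℓ2 w = 0 := by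
    intro w hw
    by_cases h2 : evalPt ℓ2 w = 0
    · exact Or.inr h2
    · left
      have : w ∈ restW (k + 3) X ℓ \ nodesOn (restW (k + 3) X ℓ) ℓ2 := mem_offLine.mpr ⟨hw, h2⟩
      rw [← hs1] at this
      exact (mem_nodesOn.mp this).2
  have hW1 : ∀ w ∈ restW (k + 3) X ℓ, evalPt ℓ1 w = 0 → evalPt ℓ2 w ≠ 0 := by
    intro w hw h1
    have : w ∈ nodesOn (restW (k + 3) X ℓ) ℓ1 := mem_nodesOn.mpr ⟨hw, h1⟩
    rw [← hs2] at this
    exact (mem_offLine.mp (mem_nodesOn.mp this).1).2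
  have hW2 : ∀ w ∈ restW (k + 3) X ℓ, evalPt ℓ2 w = 0 → evalPt ℓ1 w ≠ 0 :=
    fun w hw h2 h1 => hW1 w hw h1 h2
  have hmax : ∀ m : Poly2, m.totalDegree = 1 → (nodesOn (restW (k + 3) X ℓ) m).card = k + 3 →
      (∃ A ∈ X, evalPt m A = 0 ∧ evalPt ℓ A = 0) → IsMaximalLine (k + 3) X m := by
    rintro m hm hmc ⟨B, hB, hB1, hB2⟩
    refine ⟨hm, ?_⟩
    have h1 := h.card_line_le hm
    have h2 : insert B (nodesOn (restW (k + 3) X ℓ) m) ⊆ nodesOn X m := by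
      intro w hw
      rcases Finset.mem_insert.mp hw with rfl | hw
      · exact mem_nodesOn.mpr ⟨hB, hB1⟩
      · exact nodesOn_restW_sub hw
    have h3 := Finset.card_le_card h2
    rw [Finset.card_insert_of_notMem
      (fun h4 => (mem_restW.mp (mem_nodesOn.mp h4).1).2.1 hB2), hmc] at h3
    omega
  by_cases m1 : ∃ A ∈ X, evalPt ℓ1 A = 0 ∧ evalPt ℓ A = 0
  · by_cases m2 : ∃ A ∈ X, evalPt ℓ2 A = 0 ∧ evalPt ℓ A = 0
    · have x1 := hmax ℓ1 d1 c1 m1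
      have x2 := hmax ℓ2 d2 c2 m2
      refine ⟨ℓ1, ℓ2, x1, x2, ?_, ?_⟩
      · obtain ⟨w, hw⟩ := Finset.card_pos.mp
          (show 0 < (nodesOn (restW (k + 3) X ℓ) ℓ1).card by omega)
        obtain ⟨h1, h2⟩ := mem_nodesOn.mp hw
        exact ⟨w, h2, hW1 w h1 h2⟩
      · obtain ⟨t, ht, ht1, ht2⟩ := GCs.maximal_meet (n := k + 2) h x1 x2
        refine ⟨t, ht, ht1, ht2, ?_⟩
        by_contra h0
        by_cases hU : t ∈ usesSet (k + 3) X ℓ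
        · exact (uses_split hℓ.1 d1 d2 hW1 c1 c2 hU).2.1 ht1
        · exact hW1 t (mem_restW.mpr ⟨ht, h0, hU⟩) ht1 ht2
    · push Not at m2
      exact (Conf.false hGM h (conf_of hℓ d1 d2 hW hW1 c1 c2 m2)).elim
  · push Not at m1
    exact (Conf.false hGM h (conf_of hℓ d2 d1 (fun w hw => (hW w hw).symm) hW2 c2 c1 m1)).elim

lemma part2_one (hGM : ∀ m ≤ 1, GM m) {X : Finset (ℝ × ℝ)} (h : GCs 1 X)
    {ℓ : Poly2} (hℓ : IsKNodeLine X ℓ 1) :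
    ∃ σ τ : Poly2, IsMaximalLine 1 X σ ∧ IsMaximalLine 1 X τ ∧
      (∃ Q, evalPt σ Q = 0 ∧ evalPt τ Q ≠ 0) ∧
      ∃ a ∈ X, evalPt σ a = 0 ∧ evalPt τ a = 0 ∧ evalPt ℓ a = 0 := by
  have hXc : X.card = 3 := h.card
  have h1 := card_offLine X ℓ
  rw [hℓ.2] at h1
  obtain ⟨u, hu, v, hv, huv⟩ := Finset.one_lt_card.mp (show 1 < (X \ nodesOn X ℓ).card by omega)
  obtain ⟨a, ha⟩ := Finset.card_pos.mp (show 0 < (nodesOn X ℓ).card by rw [hℓ.2]; omega)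
  obtain ⟨huX, huℓ⟩ := mem_offLine.mp hu
  obtain ⟨hvX, hvℓ⟩ := mem_offLine.mp hv
  obtain ⟨haX, haℓ⟩ := mem_nodesOn.mp ha
  have all : ∀ w ∈ X, ∃ σ, IsMaximalLine 1 X σ ∧ evalPt σ w ≠ 0 ∧
      ∀ x ∈ X, x ≠ w → evalPt σ x = 0 := by
    intro w hw
    obtain ⟨σ, hσ, hσw⟩ := exists_maximal_avoid 0 hGM X h w hw
    refine ⟨σ, hσ, hσw, ?_⟩
    have h2 : nodesOn X σ ⊆ X.erase w := by
      intro x hx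
      obtain ⟨h3, h4⟩ := mem_nodesOn.mp hx
      exact Finset.mem_erase.mpr ⟨fun e => hσw (e ▸ h4), h3⟩
    have h3 := Finset.eq_of_subset_of_card_le h2 (by
      rw [Finset.card_erase_of_mem hw, hσ.2, hXc])
    intro x hx hxw
    have : x ∈ nodesOn X σ := by rw [h3]; exact Finset.mem_erase.mpr ⟨hxw, hx⟩
    exact (mem_nodesOn.mp this).2
  obtain ⟨σ, hσ, hσu, hσx⟩ := all u huX
  obtain ⟨τ, hτ, hτv, hτx⟩ := all v hvX
  exact ⟨σ, τ, hσ, hτ, ⟨v, hσx v hvX huv.symm, hτv⟩, a, haX,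
    hσx a haX (fun e => huℓ (e ▸ haℓ)), hτx a haX (fun e => hvℓ (e ▸ haℓ)), haℓ⟩

lemma part2_two (hGM : ∀ m ≤ 2, GM m) {X : Finset (ℝ × ℝ)} (h : GCs 2 X)
    {ℓ : Poly2} (hℓ : IsKNodeLine X ℓ 2) (hc : (usesSet 2 X ℓ).card = 0) :
    ∃ σ τ : Poly2, IsMaximalLine 2 X σ ∧ IsMaximalLine 2 X τ ∧
      (∃ Q, evalPt σ Q = 0 ∧ evalPt τ Q ≠ 0) ∧
      ∃ a ∈ X, evalPt σ a = 0 ∧ evalPt τ a = 0 ∧ evalPt ℓ a = 0 := by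
  obtain ⟨a, b, hab, hs⟩ := Finset.card_eq_two.mp hℓ.2
  have ha : a ∈ nodesOn X ℓ := by rw [hs]; simp
  have hb : b ∈ nodesOn X ℓ := by rw [hs]; simp
  obtain ⟨haX, haℓ⟩ := mem_nodesOn.mp ha
  obtain ⟨hbX, hbℓ⟩ := mem_nodesOn.mp hb
  have meet : ∀ σ, IsMaximalLine 2 X σ → evalPt σ a = 0 ∨ evalPt σ b = 0 := by
    intro σ hσ
    by_contra hcon
    push Not at hcon
    have h1 := part1_card (n := 1) h hℓ hσ (by
      rintro A hA ⟨h1, h2⟩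
      have : A ∈ nodesOn X ℓ := mem_nodesOn.mpr ⟨hA, h2⟩
      rw [hs, Finset.mem_insert, Finset.mem_singleton] at this
      rcases this with rfl | rfl
      · exact hcon.1 h1
      · exact hcon.2 h1)
    have h2 : (1 + 1).choose 2 = 1 := rfl
    rw [h2] at h1
    have h3 : (usesSet 2 X ℓ).card = 1 := h1
    omega
  obtain ⟨α, β, γ, hα, hβ, hγ, ⟨P, -, hP1, hP2, hP3⟩, ⟨Q, -, hQ1, hQ2, hQ3⟩, -⟩ :=
    three_lines (n := 1) h (exists_maximal_avoid 1 hGM X h)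
  rcases meet α hα with h1 | h1 <;> rcases meet β hβ with h2 | h2
  · exact ⟨α, β, hα, hβ, ⟨Q, hQ1, hQ3⟩, a, haX, h1, h2, haℓ⟩
  · rcases meet γ hγ with h3 | h3
    · exact ⟨α, γ, hα, hγ, ⟨P, hP1, hP3⟩, a, haX, h1, h3, haℓ⟩
    · exact ⟨β, γ, hβ, hγ, ⟨P, hP2, hP3⟩, b, hbX, h2, h3, hbℓ⟩
  · rcases meet γ hγ with h3 | h3
    · exact ⟨β, γ, hβ, hγ, ⟨P, hP2, hP3⟩, a, haX, h2, h3, haℓ⟩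
    · exact ⟨α, γ, hα, hγ, ⟨P, hP1, hP3⟩, b, hbX, h1, h3, hbℓ⟩
  · exact ⟨α, β, hα, hβ, ⟨Q, hQ1, hQ3⟩, b, hbX, h1, h2, hbℓ⟩

/-- Assuming GM up to degree `n`, for a `GC_n` set `X` with `n ≥ 1`, `n ≠ 3`,
and an `n`-node line `ℓ`:
(i) `|X_ℓ| = (n choose 2)` iff there is a maximal line `λ` with `λ ∩ ℓ ∩ X = ∅`,
and in this case `X_ℓ = X \ (λ ∪ ℓ)`;
(ii) `|X_ℓ| = (n-1 choose 2)` iff there are two (distinct) maximal lines `λ', λ''` with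
`λ' ∩ λ'' ∩ ℓ ∈ X`, and in this case `X_ℓ = X \ (λ' ∪ λ'' ∪ ℓ)`. -/
theorem stmt_5 (n : ℕ) (hGM : ∀ m ≤ n, GM m) (hn1 : 1 ≤ n) (hn3 : n ≠ 3)
    (X : Finset (ℝ × ℝ)) (hX : IsGC n X)
    (ℓ : Poly2) (hℓ : IsKNodeLine X ℓ n) :
    ((usesSet n X ℓ).card = n.choose 2 ↔
      ∃ lam : Poly2, IsMaximalLine n X lam ∧
        ∀ A ∈ X, ¬(evalPt lam A = 0 ∧ evalPt ℓ A = 0)) ∧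
    (∀ lam : Poly2, IsMaximalLine n X lam →
      (∀ A ∈ X, ¬(evalPt lam A = 0 ∧ evalPt ℓ A = 0)) →
      usesSet n X ℓ = (X \ nodesOn X lam) \ nodesOn X ℓ) ∧
    ((usesSet n X ℓ).card = (n - 1).choose 2 ↔
      ∃ lam' lam'' : Poly2, IsMaximalLine n X lam' ∧ IsMaximalLine n X lam'' ∧
        zeroSet lam' ≠ zeroSet lam'' ∧
        ∃ A ∈ X, evalPt lam' A = 0 ∧ evalPt lam'' A = 0 ∧ evalPt ℓ A = 0) ∧
    (∀ lam' lam'' : Poly2, IsMaximalLine n X lam' → IsMaximalLine n X lam'' →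
      zeroSet lam' ≠ zeroSet lam'' →
      (∃ A ∈ X, evalPt lam' A = 0 ∧ evalPt lam'' A = 0 ∧ evalPt ℓ A = 0) →
      usesSet n X ℓ = ((X \ nodesOn X lam') \ nodesOn X lam'') \ nodesOn X ℓ) := by
  have h := GCs.of_isGC hX
  obtain ⟨k, rfl⟩ : ∃ k, n = k + 1 := ⟨n - 1, by omega⟩
  have hset : ∀ lam' lam'' : Poly2, IsMaximalLine (k + 1) X lam' → IsMaximalLine (k + 1) X lam'' →
      zeroSet lam' ≠ zeroSet lam'' →
      (∃ A ∈ X, evalPt lam' A = 0 ∧ evalPt lam'' A = 0 ∧ evalPt ℓ A = 0) →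
      usesSet (k + 1) X ℓ = ((X \ nodesOn X lam') \ nodesOn X lam'') \ nodesOn X ℓ ∧
      (usesSet (k + 1) X ℓ).card = k.choose 2 := by
    rintro σ τ hσ hτ hne ⟨a, ha, h1, h2, h3⟩
    exact part2_set h hℓ hσ hτ (exists_off hσ.1 hτ.1 hne) ha h1 h2 h3
  refine ⟨⟨fun hc => part1_exists h hℓ hc, ?_⟩, fun lam hlam hd => part1_set h hℓ hlam hd,
    ⟨fun hc => ?_, ?_⟩, fun σ τ hσ hτ hne ha => (hset σ τ hσ hτ hne ha).1⟩
  · rintro ⟨lam, hlam, hd⟩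
    exact part1_card h hℓ hlam hd
  · rw [Nat.add_sub_cancel] at hc
    have hex : ∃ σ τ : Poly2, IsMaximalLine (k + 1) X σ ∧ IsMaximalLine (k + 1) X τ ∧
        (∃ Q, evalPt σ Q = 0 ∧ evalPt τ Q ≠ 0) ∧
        ∃ a ∈ X, evalPt σ a = 0 ∧ evalPt τ a = 0 ∧ evalPt ℓ a = 0 := by
      match k, hGM, h, hℓ, hc with
      | 0, hGM, h, hℓ, _ => exact part2_one hGM h hℓ
      | 1, hGM, h, hℓ, hc => exact part2_two hGM h hℓ hc
      | j + 2, hGM, h, hℓ, hc => exact part2_big hGM h hℓ hc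
    obtain ⟨σ, τ, hσ, hτ, ⟨Q, hQ1, hQ2⟩, ha⟩ := hex
    refine ⟨σ, τ, hσ, hτ, fun e => hQ2 ?_, ha⟩
    have : Q ∈ zeroSet τ := by rw [← e]; exact hQ1
    exact this
  · rintro ⟨σ, τ, hσ, hτ, hne, ha⟩
    rw [Nat.add_sub_cancel]
    exact (hset σ τ hσ hτ hne ha).2
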